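/- arXiv:1809.01525 — 6 statements merged into one kernel-verified Lean document; each statement's English description precedes it below -/
import Mathlib

section
/- Let 𝒰 be an update family with diameter D, let u be an isolated stable direction for 𝒰, and let A be a finite subset of l_u. Then the set Ā = [H_u ∪ A]∖H_u is either infinite, or every point of Ā is at Euclidean distance at most D³·2^D from A. -/
open scoped Classical

/-- A site of the two-dimensional lattice. -/
abbrev Site : Type := ℤ × ℤ

/-- An update family: a finite nonempty collection of finite nonempty rules,
none containing the origin. We represent the collection as a `Finset (Finset Site)`
together with this well-formedness predicate. -/
def IsUpdateFamily (𝒰 : Finset (Finset Site)) : Prop :=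
  𝒰.Nonempty ∧ ∀ U ∈ 𝒰, U.Nonempty ∧ ((0, 0) : Site) ∉ U

/-- One step of the bootstrap percolation dynamics. -/
def bpStep (𝒰 : Finset (Finset Site)) (A : Set Site) : Set Site :=
  A ∪ {x : Site | ∃ U ∈ 𝒰, ∀ y ∈ U, x + y ∈ A}

/-- The configuration after `t` steps of the dynamics started from `A`. -/
def bpIter (𝒰 : Finset (Finset Site)) (A : Set Site) : ℕ → Set Site
  | 0 => A
  | n + 1 => bpStep 𝒰 (bpIter 𝒰 A n)

/-- The closure `[A]` of a set `A` under the bootstrap dynamics. -/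
def bpClosure (𝒰 : Finset (Finset Site)) (A : Set Site) : Set Site :=
  ⋃ n : ℕ, bpIter 𝒰 A n

/-- The unit circle `S¹ ⊆ ℝ²`. -/
def sphere2 : Set (ℝ × ℝ) := {u : ℝ × ℝ | u.1 ^ 2 + u.2 ^ 2 = 1}

/-- Inner product of a lattice site with a real vector. -/
def inner2 (x : Site) (u : ℝ × ℝ) : ℝ := (x.1 : ℝ) * u.1 + (x.2 : ℝ) * u.2

/-- The open half-plane `H_u` with outer normal `u`. -/
def halfPlane (u : ℝ × ℝ) : Set Site := {x : Site | inner2 x u < 0}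

/-- The lattice line `l_u` through the origin perpendicular to `u`. -/
def lineu (u : ℝ × ℝ) : Set Site := {x : Site | inner2 x u = 0}

/-- A direction `u` is unstable if some rule lies in `H_u`. -/
def Unstable (𝒰 : Finset (Finset Site)) (u : ℝ × ℝ) : Prop :=
  ∃ U ∈ 𝒰, (U : Set Site) ⊆ halfPlane u

/-- A direction of the unit circle is stable if it is not unstable. -/
def Stable (𝒰 : Finset (Finset Site)) (u : ℝ × ℝ) : Prop :=
  u ∈ sphere2 ∧ ¬ Unstable 𝒰 u

/-- The set of stable directions. -/
def stableSet (𝒰 : Finset (Finset Site)) : Set (ℝ × ℝ) := {u | Stable 𝒰 u}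

/-- An isolated stable direction: a stable direction not in the (topological)
closure of the set of other stable directions. -/
def IsolatedStable (𝒰 : Finset (Finset Site)) (u : ℝ × ℝ) : Prop :=
  Stable 𝒰 u ∧ u ∉ closure (stableSet 𝒰 \ {u})

/-- The open semicircle of the unit circle centred at the direction `v`. -/
def openSemicircle (v : ℝ × ℝ) : Set (ℝ × ℝ) :=
  {u ∈ sphere2 | 0 < u.1 * v.1 + u.2 * v.2}

/-- A family is supercritical if some open semicircle consists of unstable directions. -/
def Supercritical (𝒰 : Finset (Finset Site)) : Prop :=
  ∃ v ∈ sphere2, ∀ u ∈ openSemicircle v, Unstable 𝒰 u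

/-- A family is critical if it is not supercritical and some open semicircle
contains only finitely many stable directions. -/
def Critical (𝒰 : Finset (Finset Site)) : Prop :=
  ¬ Supercritical 𝒰 ∧ ∃ v ∈ sphere2, (stableSet 𝒰 ∩ openSemicircle v).Finite

/-- The difficulty `α(u)` of a direction: `0` for unstable directions, `∞` for
non-isolated stable directions, and for isolated stable directions the minimum
cardinality of a finite `Z ⊆ ℤ² ∖ H_u` such that `[H_u ∪ Z] ∖ H_u` is infinite. -/
noncomputable def dirDifficulty (𝒰 : Finset (Finset Site)) (u : ℝ × ℝ) : ℕ∞ :=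
  if Unstable 𝒰 u then 0
  else if IsolatedStable 𝒰 u then
    sInf {n : ℕ∞ | ∃ Z : Finset Site, (∀ z ∈ Z, z ∉ halfPlane u) ∧
      (bpClosure 𝒰 (halfPlane u ∪ (Z : Set Site)) \ halfPlane u).Infinite ∧ n = Z.card}
  else ⊤

/-- The difficulty `α(𝒰)` of an update family. -/
noncomputable def difficulty (𝒰 : Finset (Finset Site)) : ℕ∞ :=
  ⨅ v ∈ sphere2, ⨆ u ∈ openSemicircle v, dirDifficulty 𝒰 u

/-- The diameter `D` of an update family: `2 · max{‖x‖_∞ : x ∈ ⋃ U ∈ 𝒰, U}`. -/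
def famDiam (𝒰 : Finset (Finset Site)) : ℕ :=
  2 * 𝒰.sup (fun U => U.sup (fun x => max x.1.natAbs x.2.natAbs))

/-- The Euclidean distance between two lattice sites. -/
noncomputable def eDist (a b : Site) : ℝ :=
  Real.sqrt (((a.1 - b.1 : ℤ) : ℝ) ^ 2 + ((a.2 - b.2 : ℤ) : ℝ) ^ 2)

/-- `C` is closed under the one-dimensional update rules `𝒱`. -/
def RuleClosed (𝒱 : Set (Set ℤ)) (C : Set ℤ) : Prop :=
  ∀ V ∈ 𝒱, ∀ x, (∀ y ∈ V, x + y ∈ C) → x ∈ C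

/-- The smallest set containing `B` and closed under the rules `𝒱`. -/
def ruleHull (𝒱 : Set (Set ℤ)) (B : Set ℤ) : Set ℤ :=
  ⋂₀ {C | B ⊆ C ∧ RuleClosed 𝒱 C}

lemma subset_ruleHull (𝒱 : Set (Set ℤ)) (B : Set ℤ) : B ⊆ ruleHull 𝒱 B :=
  fun _ hx _ hC => hC.1 hx

lemma ruleHull_subset {𝒱 : Set (Set ℤ)} {B C : Set ℤ} (hB : B ⊆ C) (hC : RuleClosed 𝒱 C) :
    ruleHull 𝒱 B ⊆ C :=
  fun _ hx => hx C ⟨hB, hC⟩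

lemma ruleClosed_ruleHull (𝒱 : Set (Set ℤ)) (B : Set ℤ) : RuleClosed 𝒱 (ruleHull 𝒱 B) :=
  fun V hV x hx C hC => hC.2 V hV x fun y hy => hx y hy C hC

/-- If a hull growing from `{x | ε * x ≤ p}` in direction `ε = ±1` contains a translate of
its window of width `r` at position `p`, it contains the translate of everything beyond `p`. -/
lemma ruleHull_add_mem {𝒱 : Set (Set ℤ)} {r : ℕ} (hr : ∀ V ∈ 𝒱, ∀ y ∈ V, |y| ≤ r)
    {ε : ℤ} (hε : ε = 1 ∨ ε = -1) {p d : ℤ} {B : Set ℤ} (hB : ∀ x ∈ B, ε * x ≤ p)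
    (hw : ∀ x ∈ ruleHull 𝒱 B, p - r < ε * x → ε * x ≤ p → x + d ∈ ruleHull 𝒱 B)
    {x : ℤ} (hx : x ∈ ruleHull 𝒱 B) (hxp : p < ε * x) : x + d ∈ ruleHull 𝒱 B := by
  have key : ruleHull 𝒱 B ⊆ {x | x ∈ ruleHull 𝒱 B ∧ (p < ε * x → x + d ∈ ruleHull 𝒱 B)} := by
    refine ruleHull_subset (fun y hy => ⟨subset_ruleHull _ _ hy, fun h => ?_⟩) ?_
    · exact absurd (hB y hy) (not_le.mpr h)
    · intro V hV z hz
      refine ⟨ruleClosed_ruleHull _ _ V hV z fun y hy => (hz y hy).1, fun hzp => ?_⟩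
      refine ruleClosed_ruleHull _ _ V hV (z + d) fun y hy => ?_
      rw [add_right_comm]
      by_cases h : p < ε * (z + y)
      · exact (hz y hy).2 h
      · refine hw _ (hz y hy).1 ?_ (not_lt.mp h)
        have := abs_le.mp (hr V hV y hy)
        rcases hε with rfl | rfl <;> omega
  exact (key hx).2 hxp

/-- A finite hull extends at most `2 ^ r` beyond its generating set in either direction. -/
lemma le_of_mem_ruleHull {𝒱 : Set (Set ℤ)} {r : ℕ} (hr : ∀ V ∈ 𝒱, ∀ y ∈ V, |y| ≤ r)
    {ε : ℤ} (hε : ε = 1 ∨ ε = -1) {p : ℤ} {B : Set ℤ} (hB : ∀ x ∈ B, ε * x ≤ p)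
    (hfin : (ruleHull 𝒱 B).Finite) {x : ℤ} (hx : x ∈ ruleHull 𝒱 B) :
    ε * x ≤ p + 2 ^ r := by
  have hεε : ε * ε = 1 := by rcases hε with rfl | rfl <;> norm_num
  by_contra! hlt
  let w : ℕ → Finset ℕ := fun i =>
    (Finset.range r).filter fun k => ε * (p + i - k) ∈ ruleHull 𝒱 B
  have hpig : ∃ i j, i ≤ 2 ^ r ∧ i < j ∧ w i = w j := by
    obtain ⟨i, hi, j, hj, hne, hij⟩ :=
      Finset.exists_ne_map_eq_of_card_lt_of_maps_to (s := Finset.range (2 ^ r + 1))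
        (t := (Finset.range r).powerset) (f := w) (by simp)
        (fun i _ => Finset.mem_powerset.mpr (Finset.filter_subset _ _))
    simp only [Finset.mem_range] at hi hj
    rcases lt_or_gt_of_ne hne with h | h
    · exact ⟨i, j, by omega, h, hij⟩
    · exact ⟨j, i, by omega, h, hij.symm⟩
  obtain ⟨i, j, hi, hij, hw⟩ := hpig
  have hi' : (i : ℤ) ≤ 2 ^ r := by exact_mod_cast hi
  have hstep : ∀ y ∈ ruleHull 𝒱 B, p + i < ε * y → y + ε * (j - i) ∈ ruleHull 𝒱 B := by
    intro y hy hyp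
    refine ruleHull_add_mem hr hε (p := p + i)
      (fun z hz => (hB z hz).trans (by omega)) (fun z hz h1 h2 => ?_) hy hyp
    obtain ⟨k, hk⟩ : ∃ k : ℕ, (k : ℤ) = p + i - ε * z :=
      ⟨(p + i - ε * z).toNat, Int.toNat_of_nonneg (by omega)⟩
    have hz' : ε * (p + i - k) = z := by
      rw [hk]; linear_combination z * hεε
    have hmem : k ∈ w i := by
      simp only [w, Finset.mem_filter, Finset.mem_range]
      exact ⟨by omega, hz'.symm ▸ hz⟩
    rw [hw] at hmem
    have := (Finset.mem_filter.mp hmem).2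
    convert this using 1
    rw [← hz']; ring
  obtain ⟨m, ⟨hm, hmp⟩, hmax⟩ := Set.exists_max_image
    {y | y ∈ ruleHull 𝒱 B ∧ p + i < ε * y} (fun y => ε * y)
    (hfin.subset fun _ h => h.1) ⟨x, hx, by omega⟩
  have hshift : ε * (m + ε * (j - i)) = ε * m + (j - i) := by
    linear_combination ((j : ℤ) - i) * hεε
  have := hmax _ ⟨hstep m hm hmp, by rw [hshift]; omega⟩
  simp only [hshift] at this
  omega

/-- Every point of a finite hull is within `2 ^ r + r` of the generating set. -/
lemma exists_abs_sub_le_of_mem_ruleHull {𝒱 : Set (Set ℤ)} {r : ℕ}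
    (hr : ∀ V ∈ 𝒱, ∀ y ∈ V, |y| ≤ r) {A : Set ℤ} (hfin : (ruleHull 𝒱 A).Finite)
    {x : ℤ} (hx : x ∈ ruleHull 𝒱 A) :
    ∃ a ∈ A, |x - a| ≤ 2 ^ r + r := by
  by_contra! hfar
  set M : ℤ := 2 ^ r + r with hM
  set L := ruleHull 𝒱 {a | a ∈ A ∧ a < x - M} with hL
  set R := ruleHull 𝒱 {a | a ∈ A ∧ x + M < a} with hR
  have hsub : ∀ S ⊆ A, (ruleHull 𝒱 S).Finite := fun S hS =>
    hfin.subset (ruleHull_subset (hS.trans (subset_ruleHull _ _)) (ruleClosed_ruleHull _ _))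
  have hLle : ∀ y ∈ L, y < x - r := fun y hy => by
    have := le_of_mem_ruleHull hr (Or.inl rfl) (p := x - M - 1)
      (fun z hz => by have := hz.2; omega) (hsub _ fun _ h => h.1) hy
    omega
  have hRge : ∀ y ∈ R, x + r < y := fun y hy => by
    have := le_of_mem_ruleHull hr (Or.inr rfl) (p := -(x + M + 1))
      (fun z hz => by have := hz.2; omega) (hsub _ fun _ h => h.1) hy
    omega
  have hclosed : RuleClosed 𝒱 (L ∪ R) := by
    intro V hV z hz
    by_cases hzx : z ≤ x
    · refine Or.inl (ruleClosed_ruleHull _ _ V hV z fun y hy => (hz y hy).resolve_right fun h => ?_)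
      have := hRge _ h
      have := abs_le.mp (hr V hV y hy)
      omega
    · refine Or.inr (ruleClosed_ruleHull _ _ V hV z fun y hy => (hz y hy).resolve_left fun h => ?_)
      have := hLle _ h
      have := abs_le.mp (hr V hV y hy)
      omega
  have hA : A ⊆ L ∪ R := fun a ha => by
    rcases lt_abs.mp (hfar a ha) with h | h
    · exact Or.inl (subset_ruleHull _ _ ⟨ha, by omega⟩)
    · exact Or.inr (subset_ruleHull _ _ ⟨ha, by omega⟩)
  rcases ruleHull_subset hA hclosed hx with h | h
  · have := hLle x h; omega
  · have := hRge x h; omega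

lemma bpIter_mono (𝒰 : Finset (Finset Site)) (A : Set Site) : Monotone (bpIter 𝒰 A) :=
  monotone_nat_of_le_succ fun _ => Set.subset_union_left

lemma subset_bpClosure (𝒰 : Finset (Finset Site)) (A : Set Site) : A ⊆ bpClosure 𝒰 A :=
  Set.subset_iUnion (bpIter 𝒰 A) 0

lemma mem_bpClosure_of_rule {𝒰 : Finset (Finset Site)} {A : Set Site} {U : Finset Site}
    (hU : U ∈ 𝒰) {x : Site} (hx : ∀ y ∈ U, x + y ∈ bpClosure 𝒰 A) : x ∈ bpClosure 𝒰 A := by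
  have hx' : ∀ y : U, ∃ n, x + y ∈ bpIter 𝒰 A n := fun y => Set.mem_iUnion.mp (hx y y.2)
  choose n hn using hx'
  refine Set.mem_iUnion.mpr ⟨Finset.univ.sup n + 1, Or.inr ⟨U, hU, fun y hy => ?_⟩⟩
  exact bpIter_mono 𝒰 A (Finset.le_sup (f := n) (Finset.mem_univ (⟨y, hy⟩ : U))) (hn ⟨y, hy⟩)

lemma bpClosure_subset {𝒰 : Finset (Finset Site)} {A C : Set Site} (hA : A ⊆ C)
    (hC : ∀ U ∈ 𝒰, ∀ x, (∀ y ∈ U, x + y ∈ C) → x ∈ C) : bpClosure 𝒰 A ⊆ C := by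
  refine Set.iUnion_subset fun n => ?_
  induction n with
  | zero => exact hA
  | succ n ih =>
    rintro x (hx | ⟨U, hU, hx⟩)
    · exact ih hx
    · exact hC U hU x fun y hy => ih (hx y hy)

lemma inner2_add (x y : Site) (u : ℝ × ℝ) : inner2 (x + y) u = inner2 x u + inner2 y u := by
  simp only [inner2, Prod.fst_add, Prod.snd_add]
  push_cast
  ring

lemma inner2_sub (x y : Site) (u : ℝ × ℝ) : inner2 (x - y) u = inner2 x u - inner2 y u := by
  simp only [inner2, Prod.fst_sub, Prod.snd_sub]
  push_cast
  ring

/-- The rules induced on the line `l_u` by the half-plane `H_u`, read through `π`. -/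
def lineRules (𝒰 : Finset (Finset Site)) (u : ℝ × ℝ) (π : Site →+ ℤ) : Set (Set ℤ) :=
  {V | ∃ U ∈ 𝒰, (∀ y ∈ U, inner2 y u ≤ 0) ∧ V = π '' {y | y ∈ U ∧ y ∈ lineu u}}

section LineProcess

variable {𝒰 : Finset (Finset Site)} {u : ℝ × ℝ} {A : Set Site}

lemma exists_mem_lineu_of_not_unstable (hu : ¬ Unstable 𝒰 u) {U : Finset Site} (hU : U ∈ 𝒰)
    (hle : ∀ y ∈ U, inner2 y u ≤ 0) : ∃ y ∈ U, y ∈ lineu u := by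
  by_contra! h
  exact hu ⟨U, hU, fun y hy => lt_of_le_of_ne (hle y hy) (h y hy)⟩

/-- Above a stable half-plane, the process started from `A ⊆ l_u` stays on `l_u` and
follows the induced one-dimensional dynamics. -/
lemma bpClosure_subset_halfPlane_union (hu : ¬ Unstable 𝒰 u) (hA : A ⊆ lineu u) (π : Site →+ ℤ) :
    bpClosure 𝒰 (halfPlane u ∪ A) ⊆
      halfPlane u ∪ {x | x ∈ lineu u ∧ π x ∈ ruleHull (lineRules 𝒰 u π) (π '' A)} := by
  have hAC : A ⊆ {x | x ∈ lineu u ∧ π x ∈ ruleHull (lineRules 𝒰 u π) (π '' A)} := fun a ha =>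
    ⟨hA ha, subset_ruleHull _ _ ⟨a, ha, rfl⟩⟩
  refine bpClosure_subset (Set.union_subset_union_right _ hAC) fun U hU x hx => ?_
  have hle : ∀ y ∈ U, inner2 x u + inner2 y u ≤ 0 := fun y hy => by
    rw [← inner2_add]
    rcases hx y hy with h | h
    · exact le_of_lt h
    · exact le_of_eq h.1
  rcases lt_trichotomy (inner2 x u) 0 with h | h | h
  · exact Or.inl h
  · have hV : π '' {y | y ∈ U ∧ y ∈ lineu u} ∈ lineRules 𝒰 u π :=
      ⟨U, hU, fun y hy => by linarith [hle y hy], rfl⟩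
    refine Or.inr ⟨h, ruleClosed_ruleHull _ _ _ hV (π x) ?_⟩
    rintro _ ⟨y, ⟨hy, hyl⟩, rfl⟩
    rw [← map_add]
    refine ((hx y hy).resolve_left fun hlt => ?_).2
    have hlt : inner2 (x + y) u < 0 := hlt
    have hyl : inner2 y u = 0 := hyl
    rw [inner2_add] at hlt
    linarith
  · exact absurd ⟨U, hU, fun y hy => show inner2 y u < 0 by linarith [hle y hy]⟩ hu

/-- The induced one-dimensional hull is covered by the two-dimensional process. -/
lemma ruleHull_lineRules_subset (hu : ¬ Unstable 𝒰 u) (hA : A ⊆ lineu u) {π : Site →+ ℤ}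
    (hπ : Set.InjOn π (lineu u)) :
    ruleHull (lineRules 𝒰 u π) (π '' A) ⊆
      π '' (bpClosure 𝒰 (halfPlane u ∪ A) \ halfPlane u) := by
  have hline : ∀ {x}, x ∈ lineu u → x ∉ halfPlane u := fun {x} hx hlt =>
    absurd (show inner2 x u = 0 from hx) (ne_of_lt hlt)
  have hmem : ∀ x ∈ bpClosure 𝒰 (halfPlane u ∪ A) \ halfPlane u, x ∈ lineu u := fun x hx =>
    ((bpClosure_subset_halfPlane_union hu hA π hx.1).resolve_left hx.2).1
  have hAK : A ⊆ bpClosure 𝒰 (halfPlane u ∪ A) \ halfPlane u := fun a ha =>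
    ⟨subset_bpClosure _ _ (Or.inr ha), hline (hA ha)⟩
  refine ruleHull_subset (Set.image_mono hAK) ?_
  rintro _ ⟨U, hU, hle, rfl⟩ n hn
  obtain ⟨v, hv, hvl⟩ := exists_mem_lineu_of_not_unstable hu hU hle
  obtain ⟨k, hk, hkn⟩ := hn _ ⟨v, ⟨hv, hvl⟩, rfl⟩
  have hxl : inner2 (k - v) u = 0 := by
    rw [inner2_sub, show inner2 k u = 0 from hmem k hk, show inner2 v u = 0 from hvl, sub_zero]
  have hxn : π (k - v) = n := by rw [map_sub, hkn, add_sub_cancel_right]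
  refine ⟨k - v, ⟨mem_bpClosure_of_rule hU fun y hy => ?_, hline hxl⟩, hxn⟩
  rcases (hle y hy).lt_or_eq with hy' | hy'
  · exact subset_bpClosure _ _
      (Or.inl (show inner2 (k - v + y) u < 0 by rw [inner2_add, hxl]; linarith))
  · obtain ⟨k', hk', hkn'⟩ := hn _ ⟨y, ⟨hy, hy'⟩, rfl⟩
    have hsum : inner2 (k - v + y) u = 0 := by rw [inner2_add, hxl, hy', zero_add]
    have : k' = k - v + y := hπ (hmem k' hk') hsum (by rw [hkn', map_add, hxn])
    exact this ▸ hk'.1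

end LineProcess

/-- The lattice line `l_u` is parametrised by the coordinate that dominates on it. -/
lemma exists_dominant_coordinate {u : ℝ × ℝ} (hu : u ∈ sphere2) :
    ∃ π : Site →+ ℤ, (∀ x : Site, |π x| ≤ max x.1.natAbs x.2.natAbs) ∧
      ∀ x ∈ lineu u, |x.1| ≤ |π x| ∧ |x.2| ≤ |π x| := by
  have hu : u.1 ^ 2 + u.2 ^ 2 = 1 := hu
  have hdom : ∀ s t a b : ℝ, |s| ≤ |t| → s ^ 2 + t ^ 2 = 1 → a * s + b * t = 0 → |b| ≤ |a| := by
    intro s t a b hst hone h0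
    have ht : 0 < |t| := by
      refine abs_pos.mpr fun ht => ?_
      subst ht
      have : s = 0 := by simpa using hst
      subst this
      norm_num at hone
    have heq : |b| * |t| = |a| * |s| := by
      rw [← abs_mul, ← abs_mul, show b * t = -(a * s) by linarith, abs_neg]
    refine le_of_mul_le_mul_right ?_ ht
    rw [heq]
    exact mul_le_mul_of_nonneg_left hst (abs_nonneg a)
  rcases le_total |u.1| |u.2| with h | h
  · refine ⟨AddMonoidHom.fst ℤ ℤ, fun x => ?_, fun x hx => ⟨le_rfl, ?_⟩⟩
    · simp
    · have := hdom u.1 u.2 x.1 x.2 h hu hx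
      exact_mod_cast this
  · refine ⟨AddMonoidHom.snd ℤ ℤ, fun x => ?_, fun x hx => ⟨?_, le_rfl⟩⟩
    · simp
    · have hx : (x.1 : ℝ) * u.1 + x.2 * u.2 = 0 := hx
      have := hdom u.2 u.1 x.2 x.1 h (by linarith) (by linarith)
      exact_mod_cast this

lemma eDist_le {a b : Site} {M : ℝ} (h1 : |((a.1 - b.1 : ℤ) : ℝ)| ≤ M)
    (h2 : |((a.2 - b.2 : ℤ) : ℝ)| ≤ M) : eDist a b ≤ 2 * M := by
  have hM : 0 ≤ M := (abs_nonneg _).trans h1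
  refine Real.sqrt_le_iff.mpr ⟨by positivity, ?_⟩
  nlinarith [sq_le_sq' (abs_le.mp h1).1 (abs_le.mp h1).2,
    sq_le_sq' (abs_le.mp h2).1 (abs_le.mp h2).2]

lemma two_mul_two_pow_add_le {r : ℕ} (hr : 1 ≤ r) :
    2 * ((2 : ℝ) ^ r + r) ≤ ((2 * r : ℕ) : ℝ) ^ 3 * 2 ^ (2 * r) := by
  have h1 : (1 : ℝ) ≤ r := by exact_mod_cast hr
  have h2 : (r : ℝ) ≤ 2 ^ r := by exact_mod_cast Nat.lt_two_pow_self.le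
  have h3 : (1 : ℝ) ≤ r ^ 3 := one_le_pow₀ h1
  have h4 : (2 : ℝ) ^ r ≤ 2 ^ (2 * r) := pow_le_pow_right₀ (by norm_num) (by omega)
  have h5 : (2 : ℝ) ^ (2 * r) ≤ r ^ 3 * 2 ^ (2 * r) := le_mul_of_one_le_left (by positivity) h3
  have h6 : (0 : ℝ) ≤ 2 ^ r := by positivity
  push_cast
  rw [mul_pow, mul_assoc]
  linarith

/-- for an isolated stable direction `u` and a finite `A ⊆ l_u`,
the set `Ā = [H_u ∪ A] ∖ H_u` is infinite, or every point of `Ā` lies within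
Euclidean distance `D³·2^D` of `A`. -/
theorem one_dim_bound_2d (𝒰 : Finset (Finset Site)) (h𝒰 : IsUpdateFamily 𝒰)
    (u : ℝ × ℝ) (hu : IsolatedStable 𝒰 u)
    (A : Set Site) (hAfin : A.Finite) (hAl : A ⊆ lineu u) :
    (bpClosure 𝒰 (halfPlane u ∪ A) \ halfPlane u).Infinite ∨
      ∀ x ∈ bpClosure 𝒰 (halfPlane u ∪ A) \ halfPlane u,
        ∃ a ∈ A, eDist x a ≤ (famDiam 𝒰 : ℝ) ^ 3 * 2 ^ famDiam 𝒰 := by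
  obtain ⟨π, hπle, hπ⟩ := exists_dominant_coordinate hu.1.1
  have hstable := hu.1.2
  set r := 𝒰.sup fun U => U.sup fun x => max x.1.natAbs x.2.natAbs with hr
  have hD : famDiam 𝒰 = 2 * r := rfl
  have hle : ∀ U ∈ 𝒰, ∀ x ∈ U, max x.1.natAbs x.2.natAbs ≤ r := fun U hU x hx =>
    (Finset.le_sup (f := fun x : Site => max x.1.natAbs x.2.natAbs) hx).trans
      (Finset.le_sup (f := fun U : Finset Site => U.sup fun x => max x.1.natAbs x.2.natAbs) hU)
  have hr1 : 1 ≤ r := by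
    obtain ⟨U, hU⟩ := h𝒰.1
    obtain ⟨⟨y, hy⟩, h0⟩ := h𝒰.2 U hU
    by_contra hlt
    have := hle U hU y hy
    refine h0 ?_
    convert hy using 1
    ext <;> simp only <;> omega
  have hinj : Set.InjOn π (lineu u) := by
    intro x hx y hy hxy
    have hsub : x - y ∈ lineu u := show inner2 (x - y) u = 0 by
      rw [inner2_sub, show inner2 x u = 0 from hx, show inner2 y u = 0 from hy, sub_zero]
    have := hπ _ hsub
    rw [map_sub, hxy, sub_self, abs_zero] at this
    ext
    · exact sub_eq_zero.mp (abs_nonpos_iff.mp this.1)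
    · exact sub_eq_zero.mp (abs_nonpos_iff.mp this.2)
  rw [or_iff_not_imp_left, Set.not_infinite]
  intro hfin x hx
  obtain ⟨hxl, hxh⟩ := (bpClosure_subset_halfPlane_union hstable hAl π hx.1).resolve_left hx.2
  obtain ⟨_, ⟨a, ha, rfl⟩, hdist⟩ := exists_abs_sub_le_of_mem_ruleHull (r := r)
    (by
      rintro _ ⟨U, hU, -, rfl⟩ _ ⟨y, hy, rfl⟩
      exact (hπle y).trans (by exact_mod_cast hle U hU y hy.1))
    ((hfin.image π).subset (ruleHull_lineRules_subset hstable hAl hinj)) hxh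
  refine ⟨a, ha, ?_⟩
  have hsub : x - a ∈ lineu u := show inner2 (x - a) u = 0 by
    rw [inner2_sub, show inner2 x u = 0 from hxl, show inner2 a u = 0 from hAl ha, sub_zero]
  have hcoord := hπ _ hsub
  rw [map_sub] at hcoord
  rw [hD]
  refine (eDist_le (M := 2 ^ r + r) ?_ ?_).trans (two_mul_two_pow_add_le hr1)
  · exact_mod_cast hcoord.1.trans hdist
  · exact_mod_cast hcoord.2.trans hdist
end

section
/- Let 𝒰 be a one-dimensional update family, i.e., a finite nonempty collection of finite nonempty subsets of ℤ∖{0}, with D = 2·max{|x| : x ∈ ⋃_{U∈𝒰} U}, and let A ⊆ ℤ be finite. Then the closure [A] is either infinite, or every b ∈ [A] satisfies dist(b,A) ≤ D²·2^D. -/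
open scoped Classical

/-- A one-dimensional update family: a finite nonempty collection of finite
nonempty rules, none containing `0`. -/
def IsUpdateFamily1 (𝒰 : Finset (Finset ℤ)) : Prop :=
  𝒰.Nonempty ∧ ∀ U ∈ 𝒰, U.Nonempty ∧ (0 : ℤ) ∉ U

/-- One step of the one-dimensional bootstrap percolation dynamics. -/
def bpStep1 (𝒰 : Finset (Finset ℤ)) (A : Set ℤ) : Set ℤ :=
  A ∪ {x : ℤ | ∃ U ∈ 𝒰, ∀ y ∈ U, x + y ∈ A}

/-- The configuration after `t` steps of the one-dimensional dynamics. -/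
def bpIter1 (𝒰 : Finset (Finset ℤ)) (A : Set ℤ) : ℕ → Set ℤ
  | 0 => A
  | n + 1 => bpStep1 𝒰 (bpIter1 𝒰 A n)

/-- The closure `[A]` under the one-dimensional dynamics. -/
def bpClosure1 (𝒰 : Finset (Finset ℤ)) (A : Set ℤ) : Set ℤ :=
  ⋃ n : ℕ, bpIter1 𝒰 A n

/-- The diameter `D = 2·max{|x| : x ∈ ⋃ U ∈ 𝒰, U}` of a one-dimensional family. -/
def famDiam1 (𝒰 : Finset (Finset ℤ)) : ℕ :=
  2 * 𝒰.sup (fun U => U.sup Int.natAbs)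

/-- `S` is stable under the dynamics: no rule of `𝒰` infects a new site. -/
def IsBpClosed1 (𝒰 : Finset (Finset ℤ)) (S : Set ℤ) : Prop :=
  ∀ U ∈ 𝒰, ∀ x : ℤ, (∀ y ∈ U, x + y ∈ S) → x ∈ S

lemma bpIter1_mono (𝒰 : Finset (Finset ℤ)) (A : Set ℤ) : Monotone (bpIter1 𝒰 A) :=
  monotone_nat_of_le_succ fun _ => Set.subset_union_left

lemma subset_bpClosure1 (𝒰 : Finset (Finset ℤ)) (A : Set ℤ) : A ⊆ bpClosure1 𝒰 A :=
  fun _ hx => Set.mem_iUnion.2 ⟨0, hx⟩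

lemma isBpClosed1_bpClosure1 (𝒰 : Finset (Finset ℤ)) (A : Set ℤ) :
    IsBpClosed1 𝒰 (bpClosure1 𝒰 A) := by
  intro U hU x hx
  have h : ∀ y ∈ U, ∃ n, x + y ∈ bpIter1 𝒰 A n := fun y hy => Set.mem_iUnion.1 (hx y hy)
  choose! n hn using h
  exact Set.mem_iUnion.2 ⟨U.sup n + 1, Or.inr ⟨U, hU, fun y hy =>
    bpIter1_mono 𝒰 A (Finset.le_sup hy) (hn y hy)⟩⟩

lemma bpClosure1_subset {𝒰 : Finset (Finset ℤ)} {A C : Set ℤ} (hC : IsBpClosed1 𝒰 C)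
    (hAC : A ⊆ C) : bpClosure1 𝒰 A ⊆ C := by
  refine Set.iUnion_subset fun n => ?_
  induction n with
  | zero => exact hAC
  | succ n ih =>
    rintro x (hx | ⟨U, hU, hx⟩)
    · exact ih hx
    · exact hC U hU x fun y hy => ih (hx y hy)

lemma bpClosure1_mono (𝒰 : Finset (Finset ℤ)) {A A' : Set ℤ} (h : A ⊆ A') :
    bpClosure1 𝒰 A ⊆ bpClosure1 𝒰 A' :=
  bpClosure1_subset (isBpClosed1_bpClosure1 𝒰 A') (h.trans (subset_bpClosure1 𝒰 A'))

/-- The update family obtained from `𝒰` by reflecting every rule through the origin. -/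
noncomputable def reflectFamily1 (𝒰 : Finset (Finset ℤ)) : Finset (Finset ℤ) :=
  𝒰.image fun U => U.image fun y => -y

lemma IsBpClosed1.reflect {𝒰 : Finset (Finset ℤ)} {S : Set ℤ} (h : IsBpClosed1 𝒰 S) :
    IsBpClosed1 (reflectFamily1 𝒰) {x | -x ∈ S} := by
  intro V hV x hx
  obtain ⟨U, hU, rfl⟩ := Finset.mem_image.1 hV
  refine h U hU (-x) fun y hy => ?_
  have := hx (-y) (Finset.mem_image_of_mem _ hy)
  simpa [add_comm] using this

lemma IsBpClosed1.of_reflect {𝒰 : Finset (Finset ℤ)} {S : Set ℤ}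
    (h : IsBpClosed1 (reflectFamily1 𝒰) S) : IsBpClosed1 𝒰 {x | -x ∈ S} := by
  intro U hU x hx
  refine h _ (Finset.mem_image_of_mem _ hU) (-x) fun y hy => ?_
  obtain ⟨u, hu, rfl⟩ := Finset.mem_image.1 hy
  have := hx u hu
  simpa [add_comm] using this

lemma bpClosure1_reflect_subset (𝒰 : Finset (Finset ℤ)) (A : Set ℤ) :
    bpClosure1 (reflectFamily1 𝒰) {x | -x ∈ A} ⊆ {x | -x ∈ bpClosure1 𝒰 A} :=
  bpClosure1_subset (isBpClosed1_bpClosure1 𝒰 A).reflect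
    fun _ hx => subset_bpClosure1 𝒰 A hx

lemma bpClosure1_subset_reflect (𝒰 : Finset (Finset ℤ)) (A : Set ℤ) :
    bpClosure1 𝒰 A ⊆ {x | -x ∈ bpClosure1 (reflectFamily1 𝒰) {x | -x ∈ A}} :=
  bpClosure1_subset (isBpClosed1_bpClosure1 _ _).of_reflect
    fun x hx => subset_bpClosure1 _ _ (by simpa using hx)

/-- If the closure of a set bounded above by `m` is finite, then it cannot exceed `m` by more
than `2 ^ r`, where `r` is the range of the rules. -/
lemma bpClosure1_le_of_finite {𝒰 : Finset (Finset ℤ)} {r : ℕ}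
    (hr : ∀ U ∈ 𝒰, ∀ y ∈ U, y.natAbs ≤ r) {S : Set ℤ} {m : ℤ} (hS : ∀ s ∈ S, s ≤ m)
    (hfin : (bpClosure1 𝒰 S).Finite) : ∀ b ∈ bpClosure1 𝒰 S, b ≤ m + 2 ^ r := by
  intro b hb
  by_contra! hlt
  set B := bpClosure1 𝒰 S
  have hclosed : IsBpClosed1 𝒰 B := isBpClosed1_bpClosure1 𝒰 S
  -- Two of the first `2 ^ r + 1` windows of length `r` beyond `m` carry the same pattern.
  let pattern : ℕ → Finset ℕ := fun k =>
    (Finset.range r).filter fun i => m + k + i + 1 ∈ B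
  obtain ⟨k, l, hkl, hl, hpat⟩ : ∃ k l : ℕ, k < l ∧ l ≤ 2 ^ r ∧ pattern k = pattern l := by
    obtain ⟨k, hk, l, hl, hne, heq⟩ := Finset.exists_ne_map_eq_of_card_lt_of_maps_to
      (s := Finset.range (2 ^ r + 1)) (t := (Finset.range r).powerset) (f := pattern)
      (by simp) (fun k _ => Finset.mem_powerset.2 (Finset.filter_subset _ _))
    rw [Finset.mem_range] at hk hl
    rcases lt_or_gt_of_ne hne with h | h
    · exact ⟨k, l, h, by omega, heq⟩
    · exact ⟨l, k, h, by omega, heq.symm⟩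
  set p : ℤ := (l : ℤ) - k with hp
  have hp0 : 0 < p := by omega
  have hwindow : ∀ z ∈ B, m + k < z → z ≤ m + k + r → z + p ∈ B := by
    intro z hz h1 h2
    obtain ⟨i, hi⟩ := Int.eq_ofNat_of_zero_le (a := z - (m + k + 1)) (by omega)
    have hmem : i ∈ pattern k := by
      refine Finset.mem_filter.2 ⟨Finset.mem_range.2 (by omega), ?_⟩
      rwa [show m + k + i + 1 = z by omega]
    rw [hpat] at hmem
    have := (Finset.mem_filter.1 hmem).2
    rwa [show m + l + i + 1 = z + p by omega] at this
  have hshift : ∀ z ∈ B, m + k < z → z + p ∈ B := by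
    suffices h : B ⊆ {z | z ∈ B ∧ (m + k < z → z + p ∈ B)} from fun z hz => (h hz).2
    refine bpClosure1_subset ?_ fun s hs =>
      ⟨subset_bpClosure1 𝒰 S hs, fun h => absurd (hS s hs) (by omega)⟩
    intro U hU z hz
    have hzB : z ∈ B := hclosed U hU z fun y hy => (hz y hy).1
    refine ⟨hzB, fun h => ?_⟩
    by_cases hzr : z ≤ m + k + r
    · exact hwindow z hzB h hzr
    · refine hclosed U hU _ fun y hy => ?_
      have hy' := hr U hU y hy
      have := (hz y hy).2 (by omega)
      rwa [show z + p + y = z + y + p by ring]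
  have hkb : m + k < b := by
    have : (l : ℤ) ≤ 2 ^ r := by exact_mod_cast hl
    omega
  have hiter : ∀ n : ℕ, b + n * p ∈ B := by
    intro n
    induction n with
    | zero => simpa using hb
    | succ n ih =>
      have hn : 0 ≤ (n : ℤ) * p := by positivity
      have := hshift _ ih (by omega)
      rwa [show b + ((n + 1 : ℕ) : ℤ) * p = b + n * p + p by push_cast; ring]
  refine Set.infinite_of_injective_forall_mem (f := fun n : ℕ => b + n * p) ?_ hiter hfin
  intro i j hij
  have : (i : ℤ) * p = j * p := by simpa using hij
  exact_mod_cast mul_right_cancel₀ hp0.ne' this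

/-- Mirror image of `bpClosure1_le_of_finite`. -/
lemma le_bpClosure1_of_finite {𝒰 : Finset (Finset ℤ)} {r : ℕ}
    (hr : ∀ U ∈ 𝒰, ∀ y ∈ U, y.natAbs ≤ r) {S : Set ℤ} {m : ℤ} (hS : ∀ s ∈ S, m ≤ s)
    (hfin : (bpClosure1 𝒰 S).Finite) : ∀ b ∈ bpClosure1 𝒰 S, m - 2 ^ r ≤ b := by
  intro b hb
  have hr' : ∀ V ∈ reflectFamily1 𝒰, ∀ y ∈ V, y.natAbs ≤ r := by
    intro V hV y hy
    obtain ⟨U, hU, rfl⟩ := Finset.mem_image.1 hV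
    obtain ⟨u, hu, rfl⟩ := Finset.mem_image.1 hy
    simpa using hr U hU u hu
  have hfin' : (bpClosure1 (reflectFamily1 𝒰) {x | -x ∈ S}).Finite :=
    (hfin.preimage neg_injective.injOn).subset (bpClosure1_reflect_subset 𝒰 S)
  have := bpClosure1_le_of_finite hr' (m := -m) (fun s hs => by have := hS _ hs; omega) hfin'
    (-b) (bpClosure1_subset_reflect 𝒰 S hb)
  omega

/-- The union of two stable sets separated by more than the range of the rules is stable. -/
lemma IsBpClosed1.union {𝒰 : Finset (Finset ℤ)} {r : ℕ}
    (hr : ∀ U ∈ 𝒰, ∀ y ∈ U, y.natAbs ≤ r) {L R : Set ℤ} (hL : IsBpClosed1 𝒰 L)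
    (hR : IsBpClosed1 𝒰 R) {b : ℤ} (hLb : ∀ z ∈ L, z < b - r) (hRb : ∀ z ∈ R, b + r < z) :
    IsBpClosed1 𝒰 (L ∪ R) := by
  intro U hU z hz
  rcases le_total z b with hzb | hzb
  · refine Or.inl (hL U hU z fun y hy => (hz y hy).resolve_right fun h => ?_)
    have := hRb _ h
    have := hr U hU y hy
    omega
  · refine Or.inr (hR U hU z fun y hy => (hz y hy).resolve_left fun h => ?_)
    have := hLb _ h
    have := hr U hU y hy
    omega

/-- for a one-dimensional update family with diameter `D` and a
finite `A ⊆ ℤ`, the closure `[A]` is infinite, or every `b ∈ [A]` is within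
distance `D²·2^D` of `A`. -/
theorem one_dim_bound (𝒰 : Finset (Finset ℤ)) (h𝒰 : IsUpdateFamily1 𝒰)
    (A : Set ℤ) (hA : A.Finite) :
    (bpClosure1 𝒰 A).Infinite ∨
      ∀ b ∈ bpClosure1 𝒰 A, ∃ a ∈ A,
        |b - a| ≤ (famDiam1 𝒰 : ℤ) ^ 2 * 2 ^ famDiam1 𝒰 := by
  refine or_iff_not_imp_left.2 fun hinf b hb => ?_
  have hfin : (bpClosure1 𝒰 A).Finite := Set.not_infinite.1 hinf
  by_contra! hfar
  set r : ℕ := 𝒰.sup (fun U => U.sup Int.natAbs) with hrdef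
  have hr : ∀ U ∈ 𝒰, ∀ y ∈ U, y.natAbs ≤ r := fun U hU y hy =>
    (Finset.le_sup (f := Int.natAbs) hy).trans
      (Finset.le_sup (f := fun U : Finset ℤ => U.sup Int.natAbs) hU)
  have hr1 : 1 ≤ r := by
    obtain ⟨U, hU⟩ := h𝒰.1
    obtain ⟨⟨y, hy⟩, h0⟩ := h𝒰.2 U hU
    have := hr U hU y hy
    have : y ≠ 0 := fun h => h0 (h ▸ hy)
    omega
  obtain ⟨N, hN⟩ : ∃ N : ℤ, N = (famDiam1 𝒰 : ℤ) ^ 2 * 2 ^ famDiam1 𝒰 := ⟨_, rfl⟩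
  rw [← hN] at hfar
  have hNr : 2 ^ r + (r : ℤ) ≤ N := by
    have hpow : (1 : ℤ) ≤ 2 ^ r := one_le_pow₀ (by norm_num)
    have hrz : (1 : ℤ) ≤ r := by exact_mod_cast hr1
    have hN' : N = 4 * ((r : ℤ) * 2 ^ r) ^ 2 := by
      rw [hN, famDiam1, ← hrdef, mul_comm 2 r, pow_mul]
      push_cast
      ring
    have h1 : (r : ℤ) ≤ r * 2 ^ r := by nlinarith
    have h2 : (2 : ℤ) ^ r ≤ r * 2 ^ r := by nlinarith
    nlinarith
  have hLb := bpClosure1_le_of_finite hr (S := A ∩ Set.Iic b) (m := b - N - 1)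
    (fun s hs => by
      have h := hfar s hs.1
      rw [abs_of_nonneg (sub_nonneg.2 hs.2)] at h
      omega)
    (hfin.subset (bpClosure1_mono 𝒰 Set.inter_subset_left))
  have hRb := le_bpClosure1_of_finite hr (S := A ∩ Set.Ici b) (m := b + N + 1)
    (fun s hs => by
      have h := hfar s hs.1
      rw [abs_of_nonpos (sub_nonpos.2 hs.2)] at h
      omega)
    (hfin.subset (bpClosure1_mono 𝒰 Set.inter_subset_left))
  have hsub := bpClosure1_subset
    (IsBpClosed1.union hr (isBpClosed1_bpClosure1 𝒰 (A ∩ Set.Iic b))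
      (isBpClosed1_bpClosure1 𝒰 (A ∩ Set.Ici b)) (b := b)
      (fun z hz => by have := hLb z hz; omega) (fun z hz => by have := hRb z hz; omega))
    (A := A) fun a ha => (le_total a b).imp
      (fun h => subset_bpClosure1 𝒰 _ ⟨ha, h⟩) (fun h => subset_bpClosure1 𝒰 _ ⟨ha, h⟩)
  rcases hsub hb with h | h
  · have := hLb b h
    omega
  · have := hRb b h
    omega
end

section
/- There exists a constant C > 0 such that the following holds for every critical update family 𝒰 with diameter D and every isolated stable direction u of 𝒰: if Z ⊆ {x ∈ ℤ² : ⟨x,u⟩ > 0} has cardinality at most D, then every z ∈ [Z] satisfies ⟨z,u⟩ ≥ −C·D⁴. -/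
open scoped Classical

lemma abs_le_of_mem_rule {𝒰 : Finset (Finset Site)} {U : Finset Site} (hU : U ∈ 𝒰)
    {x : Site} (hx : x ∈ U) :
    2 * |(x.1 : ℝ)| ≤ famDiam 𝒰 ∧ 2 * |(x.2 : ℝ)| ≤ famDiam 𝒰 := by
  have h1 : max x.1.natAbs x.2.natAbs ≤
      𝒰.sup (fun U => U.sup (fun x => max x.1.natAbs x.2.natAbs)) :=
    (Finset.le_sup (f := fun x : Site => max x.1.natAbs x.2.natAbs) hx).trans
      (Finset.le_sup (f := fun U : Finset Site =>
        U.sup (fun x => max x.1.natAbs x.2.natAbs)) hU)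
  have h2 : 2 * x.1.natAbs ≤ famDiam 𝒰 := by unfold famDiam; omega
  have h3 : 2 * x.2.natAbs ≤ famDiam 𝒰 := by unfold famDiam; omega
  have h4 : ((2 * x.1.natAbs : ℕ) : ℝ) ≤ famDiam 𝒰 := by exact_mod_cast h2
  have h5 : ((2 * x.2.natAbs : ℕ) : ℝ) ≤ famDiam 𝒰 := by exact_mod_cast h3
  push_cast [Nat.cast_natAbs] at h4 h5
  exact ⟨h4, h5⟩

lemma inner2_smul (x : Site) (a : ℝ) (u : ℝ × ℝ) : inner2 x (a • u) = a * inner2 x u := by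
  simp only [inner2, Prod.smul_fst, Prod.smul_snd, smul_eq_mul]; ring

lemma continuous_inner2 (x : Site) : Continuous (inner2 x) := by
  unfold inner2; fun_prop

lemma not_unstable_smul {𝒰 : Finset (Finset Site)} {v : ℝ × ℝ}
    (hv : ¬ Unstable 𝒰 v) {a : ℝ} (ha : 0 ≤ a) : ¬ Unstable 𝒰 (a • v) := by
  rintro ⟨U, hU, h⟩
  refine hv ⟨U, hU, fun x hx => ?_⟩
  have h1 : inner2 x (a • v) < 0 := h hx
  rw [inner2_smul] at h1
  exact (pos_iff_neg_of_mul_neg h1).1 (ha.lt_of_ne (by rintro rfl; simp at h1))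

lemma isOpen_setOf_unstable (𝒰 : Finset (Finset Site)) : IsOpen {v | Unstable 𝒰 v} := by
  have : {v | Unstable 𝒰 v} = ⋃ U ∈ 𝒰, ⋂ x ∈ U, {v | inner2 x v < 0} := by
    ext v; simp [Unstable, halfPlane, Set.subset_def]
  rw [this]
  refine isOpen_biUnion fun U _ => isOpen_biInter_finset fun x _ => ?_
  exact isOpen_lt (continuous_inner2 x) continuous_const

/-- A stable direction that is a limit of unstable ones is perpendicular to a rule element. -/
lemma exists_perp_of_mem_closure {𝒰 : Finset (Finset Site)} {v : ℝ × ℝ}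
    (hv : ¬ Unstable 𝒰 v) (hc : v ∈ closure {w | Unstable 𝒰 w}) :
    ∃ U ∈ 𝒰, ∃ x ∈ U, inner2 x v = 0 := by
  have hcl : IsClosed (⋃ U ∈ 𝒰, ⋂ x ∈ U, {v | inner2 x v ≤ 0}) :=
    Set.Finite.isClosed_biUnion 𝒰.finite_toSet fun U _ =>
      isClosed_biInter fun x _ => isClosed_le (continuous_inner2 x) continuous_const
  have hsub : {w | Unstable 𝒰 w} ⊆ ⋃ U ∈ 𝒰, ⋂ x ∈ U, {v | inner2 x v ≤ 0} := by
    rintro w ⟨U, hU, h⟩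
    simp only [Set.mem_iUnion, Set.mem_iInter]
    exact ⟨U, hU, fun x hx => (show inner2 x w < 0 from h hx).le⟩
  have hm := closure_minimal hsub hcl hc
  simp only [Set.mem_iUnion, Set.mem_iInter] at hm
  obtain ⟨U, hU, h⟩ := hm
  refine ⟨U, hU, ?_⟩
  by_contra! hne
  exact hv ⟨U, hU, fun x hx => lt_of_le_of_ne (h x hx) (hne x hx)⟩

/-- The direction at angle `t` from `n`. -/
noncomputable def rotate (n : ℝ × ℝ) (t : ℝ) : ℝ × ℝ :=
  (Real.cos t * n.1 - Real.sin t * n.2, Real.cos t * n.2 + Real.sin t * n.1)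

lemma continuous_rotate (n : ℝ × ℝ) : Continuous (rotate n) := by
  unfold rotate; fun_prop

lemma rotate_mem_sphere2 {n : ℝ × ℝ} (hn : n ∈ sphere2) (t : ℝ) : rotate n t ∈ sphere2 := by
  have hn' : n.1 ^ 2 + n.2 ^ 2 = 1 := hn
  simp only [sphere2, rotate, Set.mem_ofPred_eq]
  linear_combination (Real.cos t ^ 2 + Real.sin t ^ 2) * hn' + Real.sin_sq_add_cos_sq t

/-- Every point of the open semicircle around `rotate n m` has an angle within `π / 2` of `m`. -/
lemma exists_angle_of_mem_openSemicircle {n : ℝ × ℝ} (hn : n ∈ sphere2) {m : ℝ} {w : ℝ × ℝ}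
    (hw : w ∈ openSemicircle (rotate n m)) :
    ∃ t, m - Real.pi / 2 < t ∧ t < m + Real.pi / 2 ∧ rotate n t = w := by
  obtain ⟨hw1, hw2⟩ := hw
  have hn' : n.1 ^ 2 + n.2 ^ 2 = 1 := hn
  have hw1' : w.1 ^ 2 + w.2 ^ 2 = 1 := hw1
  have hk := rotate_mem_sphere2 hn m
  obtain ⟨k1, k2, hr⟩ : ∃ k1 k2, rotate n m = (k1, k2) := ⟨_, _, rfl⟩
  rw [hr] at hw2 hk
  have hk' : k1 ^ 2 + k2 ^ 2 = 1 := hk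
  simp only [rotate, Prod.mk.injEq] at hr
  simp only at hw2
  set c := w.1 * k1 + w.2 * k2 with hc
  set s := w.2 * k1 - w.1 * k2 with hs
  have hcs : c ^ 2 + s ^ 2 = 1 := by
    rw [hc, hs]; linear_combination (k1 ^ 2 + k2 ^ 2) * hw1' + hk'
  have hcos : Real.cos (Real.arcsin s) = c := by
    rw [Real.cos_arcsin, show 1 - s ^ 2 = c ^ 2 by linarith, Real.sqrt_sq hw2.le]
  have hs1 : s ^ 2 < 1 := by nlinarith
  have hsin : Real.sin (Real.arcsin s) = s :=
    Real.sin_arcsin (by nlinarith) (by nlinarith)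
  have hlt := abs_lt.1 ((sq_lt_one_iff_abs_lt_one s).1 hs1)
  refine ⟨m + Real.arcsin s, ?_, ?_, ?_⟩
  · linarith [Real.neg_pi_div_two_lt_arcsin.2 hlt.1]
  · linarith [Real.arcsin_lt_pi_div_two.2 hlt.2]
  · obtain ⟨h1, h2⟩ := hr
    ext
    · simp only [rotate, Real.cos_add, Real.sin_add, hcos, hsin]
      have : c * k1 - s * k2 = w.1 := by rw [hc, hs]; linear_combination w.1 * hk'
      rw [← this, ← h1, ← h2]; ring
    · simp only [rotate, Real.cos_add, Real.sin_add, hcos, hsin]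
      have : c * k2 + s * k1 = w.2 := by rw [hc, hs]; linear_combination w.2 * hk'
      rw [← this, ← h1, ← h2]; ring

/-- Two directions perpendicular to lattice points in a box of side `D` and not parallel to
each other span an angle whose sine is at least of order `D⁻²`. -/
lemma one_le_mul_of_perp {v w : ℝ × ℝ} (hv : v ∈ sphere2) (hw : w ∈ sphere2) {x y : Site}
    (hx0 : x ≠ (0, 0)) (hy0 : y ≠ (0, 0)) (hxv : inner2 x v = 0) (hyw : inner2 y w = 0)
    {D s : ℝ} (hx : 2 * |(x.1 : ℝ)| ≤ D ∧ 2 * |(x.2 : ℝ)| ≤ D)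
    (hy : 2 * |(y.1 : ℝ)| ≤ D ∧ 2 * |(y.2 : ℝ)| ≤ D)
    (hs : 0 < s) (hsvw : w.1 * v.2 - w.2 * v.1 = s) : 1 ≤ D ^ 2 * s := by
  have hv' : v.1 ^ 2 + v.2 ^ 2 = 1 := hv
  have hw' : w.1 ^ 2 + w.2 ^ 2 = 1 := hw
  simp only [inner2] at hxv hyw
  obtain ⟨k, hk⟩ : ∃ k, k = x.2 * v.1 - x.1 * v.2 := ⟨_, rfl⟩
  obtain ⟨l, hl⟩ : ∃ l, l = y.2 * w.1 - y.1 * w.2 := ⟨_, rfl⟩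
  have hx1 : (x.1 : ℝ) = -k * v.2 := by
    rw [hk]; linear_combination -x.1 * hv' + v.1 * hxv
  have hx2 : (x.2 : ℝ) = k * v.1 := by
    rw [hk]; linear_combination -x.2 * hv' + v.2 * hxv
  have hy1 : (y.1 : ℝ) = -l * w.2 := by
    rw [hl]; linear_combination -y.1 * hw' + w.1 * hyw
  have hy2 : (y.2 : ℝ) = l * w.1 := by
    rw [hl]; linear_combination -y.2 * hw' + w.2 * hyw
  have hcross : ((x.2 * y.1 - x.1 * y.2 : ℤ) : ℝ) = k * l * s := by
    push_cast; rw [hx1, hx2, hy1, hy2, ← hsvw]; ring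
  have hk0 : k ≠ 0 := by
    rintro rfl
    apply hx0
    ext
    · simpa using hx1
    · simpa using hx2
  have hl0 : l ≠ 0 := by
    rintro rfl
    apply hy0
    ext
    · simpa using hy1
    · simpa using hy2
  have hne : (x.2 * y.1 - x.1 * y.2 : ℤ) ≠ 0 := by
    intro h
    rw [h, Int.cast_zero] at hcross
    exact mul_ne_zero (mul_ne_zero hk0 hl0) hs.ne' hcross.symm
  have h1 : (1 : ℝ) ≤ |k| * |l| * s := by
    have h : (1 : ℝ) ≤ |((x.2 * y.1 - x.1 * y.2 : ℤ) : ℝ)| := by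
      exact_mod_cast Int.one_le_abs hne
    rwa [hcross, abs_mul, abs_mul, abs_of_pos hs] at h
  have hD : 0 ≤ D := (by positivity : (0 : ℝ) ≤ 2 * |(x.1 : ℝ)|).trans hx.1
  have hkD : |k| ≤ D := by
    refine abs_le_of_sq_le_sq (?_ : k ^ 2 ≤ D ^ 2) hD
    have e : k ^ 2 = |(x.1 : ℝ)| ^ 2 + |(x.2 : ℝ)| ^ 2 := by
      rw [sq_abs, sq_abs, hx1, hx2]; linear_combination -k ^ 2 * hv'
    nlinarith [abs_nonneg (x.1 : ℝ), abs_nonneg (x.2 : ℝ)]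
  have hlD : |l| ≤ D := by
    refine abs_le_of_sq_le_sq (?_ : l ^ 2 ≤ D ^ 2) hD
    have e : l ^ 2 = |(y.1 : ℝ)| ^ 2 + |(y.2 : ℝ)| ^ 2 := by
      rw [sq_abs, sq_abs, hy1, hy2]; linear_combination -l ^ 2 * hw'
    nlinarith [abs_nonneg (y.1 : ℝ), abs_nonneg (y.2 : ℝ)]
  have : |k| * |l| ≤ D * D := mul_le_mul hkD hlD (abs_nonneg _) hD
  nlinarith

lemma abs_le_one_of_mem_sphere2 {v : ℝ × ℝ} (hv : v ∈ sphere2) : |v.1| ≤ 1 ∧ |v.2| ≤ 1 := by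
  have hv' : v.1 ^ 2 + v.2 ^ 2 = 1 := hv
  rw [← sq_le_one_iff_abs_le_one, ← sq_le_one_iff_abs_le_one]
  constructor <;> nlinarith [sq_nonneg v.1, sq_nonneg v.2]

/-- A stable direction of a family that is not supercritical is balanced by two vectors of
controlled length, neither of which is unstable. -/
lemma exists_balancing {𝒰 : Finset (Finset Site)} (h𝒰 : IsUpdateFamily 𝒰)
    (hsc : ¬ Supercritical 𝒰) {u : ℝ × ℝ} (hu : Stable 𝒰 u) :
    ∃ V W : ℝ × ℝ, ¬ Unstable 𝒰 V ∧ ¬ Unstable 𝒰 W ∧ u + V + W = 0 ∧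
      (|V.1| ≤ (famDiam 𝒰 : ℝ) ^ 2 ∧ |V.2| ≤ (famDiam 𝒰 : ℝ) ^ 2) ∧
      (|W.1| ≤ (famDiam 𝒰 : ℝ) ^ 2 ∧ |W.2| ≤ (famDiam 𝒰 : ℝ) ^ 2) := by
  obtain ⟨hus, hun⟩ := hu
  have hn : -u ∈ sphere2 := by simpa [sphere2] using hus
  have hπ := Real.pi_pos
  set S : Set ℝ := {t | ¬ Unstable 𝒰 (rotate (-u) t)} with hS
  have hScl : IsClosed S :=
    (isOpen_setOf_unstable 𝒰).isClosed_compl.preimage (continuous_rotate (-u))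
  have hpi : Real.pi ∈ S := by simpa [hS, rotate] using hun
  have hnpi : -Real.pi ∈ S := by simpa [hS, rotate] using hun
  by_cases h0 : (0 : ℝ) ∈ S
  · have h0' : ¬ Unstable 𝒰 (-u) := by
      have hr : rotate (-u) 0 = -u := by ext <;> simp [rotate]
      rw [← hr]; exact h0
    have hz : ¬ Unstable 𝒰 0 := by simpa using not_unstable_smul hun le_rfl
    have hD : (1 : ℝ) ≤ (famDiam 𝒰 : ℝ) ^ 2 := by
      obtain ⟨U, hU⟩ := h𝒰.1
      obtain ⟨⟨x, hx⟩, h0U⟩ := h𝒰.2 U hU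
      have hne : famDiam 𝒰 ≠ 0 := by
        intro h
        have hb := abs_le_of_mem_rule hU hx
        rw [h, Nat.cast_zero] at hb
        have e1 : (x.1 : ℝ) = 0 := abs_nonpos_iff.1 (by linarith [hb.1])
        have e2 : (x.2 : ℝ) = 0 := abs_nonpos_iff.1 (by linarith [hb.2])
        apply h0U
        convert hx
        · exact_mod_cast e1.symm
        · exact_mod_cast e2.symm
      exact_mod_cast Nat.one_le_pow _ _ (Nat.pos_of_ne_zero hne)
    have hb := abs_le_one_of_mem_sphere2 hn
    refine ⟨-u, 0, h0', hz, by simp, ⟨hb.1.trans hD, hb.2.trans hD⟩, ?_, ?_⟩ <;>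
      simp
  obtain ⟨p, ⟨hpS, hp⟩, hpmin⟩ := (isCompact_Icc.inter_left hScl).exists_isLeast
    ⟨Real.pi, hpi, hπ.le, le_rfl⟩
  obtain ⟨q, ⟨hqS, hq⟩, hqmax⟩ := (isCompact_Icc.inter_left hScl).exists_isGreatest
    ⟨-Real.pi, hnpi, le_rfl, neg_nonpos.2 hπ.le⟩
  have hp0 : 0 < p := hp.1.lt_of_ne (by rintro rfl; exact h0 hpS)
  have hq0 : q < 0 := hq.2.lt_of_ne (by rintro rfl; exact h0 hqS)
  have harc : ∀ t, q < t → t < p → Unstable 𝒰 (rotate (-u) t) := by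
    intro t hqt htp
    by_contra h
    rcases le_total 0 t with h' | h'
    · exact htp.not_ge (hpmin ⟨h, h', htp.le.trans hp.2⟩)
    · exact hqt.not_ge (hqmax ⟨h, hq.1.trans hqt.le, h'⟩)
  have hlt : p - q < Real.pi := by
    by_contra! hge
    refine hsc ⟨rotate (-u) ((p + q) / 2), rotate_mem_sphere2 hn _, fun w hw => ?_⟩
    obtain ⟨t, ht1, ht2, rfl⟩ := exists_angle_of_mem_openSemicircle hn hw
    exact harc t (by linarith) (by linarith)
  have hclos : ∀ r ∈ Set.Icc q p, rotate (-u) r ∈ closure {w | Unstable 𝒰 w} := by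
    intro r hr
    rw [← closure_Ioo (hq0.trans hp0).ne] at hr
    refine closure_mono ?_ (image_closure_subset_closure_image (continuous_rotate (-u))
      ⟨r, hr, rfl⟩)
    rintro _ ⟨t, ht, rfl⟩
    exact harc t ht.1 ht.2
  obtain ⟨U, hU, x, hx, hxp⟩ :=
    exists_perp_of_mem_closure hpS (hclos p ⟨(hq0.trans hp0).le, le_rfl⟩)
  obtain ⟨U', hU', y, hy, hyq⟩ :=
    exists_perp_of_mem_closure hqS (hclos q ⟨le_rfl, (hq0.trans hp0).le⟩)
  have hx0 : x ≠ (0, 0) := fun h => (h𝒰.2 U hU).2 (h ▸ hx)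
  have hy0 : y ≠ (0, 0) := fun h => (h𝒰.2 U' hU').2 (h ▸ hy)
  have hspos : 0 < Real.sin (p - q) := Real.sin_pos_of_pos_of_lt_pi (by linarith) hlt
  have hn' : u.1 ^ 2 + u.2 ^ 2 = 1 := hus
  have hs := one_le_mul_of_perp (rotate_mem_sphere2 hn p) (rotate_mem_sphere2 hn q) hx0 hy0
    hxp hyq (abs_le_of_mem_rule hU hx) (abs_le_of_mem_rule hU' hy) hspos (by
      simp only [rotate, Real.sin_sub, Prod.fst_neg, Prod.snd_neg]
      linear_combination (Real.sin p * Real.cos q - Real.cos p * Real.sin q) * hn')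
  have hle : 1 / Real.sin (p - q) ≤ (famDiam 𝒰 : ℝ) ^ 2 := by rwa [div_le_iff₀ hspos]
  have ha0 : 0 ≤ -Real.sin q / Real.sin (p - q) := by
    refine div_nonneg ?_ hspos.le
    rw [← Real.sin_neg]
    exact Real.sin_nonneg_of_nonneg_of_le_pi (by linarith) (by linarith [hq.1])
  have hb0 : 0 ≤ Real.sin p / Real.sin (p - q) :=
    div_nonneg (Real.sin_nonneg_of_nonneg_of_le_pi hp.1 hp.2) hspos.le
  have ha : -Real.sin q / Real.sin (p - q) ≤ (famDiam 𝒰 : ℝ) ^ 2 :=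
    (div_le_div_of_nonneg_right (by linarith [Real.neg_one_le_sin q]) hspos.le).trans hle
  have hb : Real.sin p / Real.sin (p - q) ≤ (famDiam 𝒰 : ℝ) ^ 2 :=
    (div_le_div_of_nonneg_right (Real.sin_le_one p) hspos.le).trans hle
  have hbound : ∀ (a t : ℝ), 0 ≤ a → a ≤ (famDiam 𝒰 : ℝ) ^ 2 →
      |(a • rotate (-u) t).1| ≤ (famDiam 𝒰 : ℝ) ^ 2 ∧
      |(a • rotate (-u) t).2| ≤ (famDiam 𝒰 : ℝ) ^ 2 := by
    intro a t h1 h2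
    have h3 := abs_le_one_of_mem_sphere2 (rotate_mem_sphere2 hn t)
    simp only [Prod.smul_fst, Prod.smul_snd, smul_eq_mul, abs_mul, abs_of_nonneg h1]
    exact ⟨(mul_le_of_le_one_right h1 h3.1).trans h2, (mul_le_of_le_one_right h1 h3.2).trans h2⟩
  refine ⟨(-Real.sin q / Real.sin (p - q)) • rotate (-u) p,
    (Real.sin p / Real.sin (p - q)) • rotate (-u) q, not_unstable_smul hpS ha0,
    not_unstable_smul hqS hb0, ?_, hbound _ _ ha0 ha, hbound _ _ hb0 hb⟩
  have hsin := Real.sin_sub p q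
  ext
  · simp only [rotate, Prod.fst_add, Prod.smul_fst, smul_eq_mul, Prod.fst_neg, Prod.snd_neg,
      Prod.fst_zero]
    field_simp
    rw [hsin]; ring
  · simp only [rotate, Prod.snd_add, Prod.smul_snd, smul_eq_mul, Prod.fst_neg, Prod.snd_neg,
      Prod.snd_zero]
    field_simp
    rw [hsin]; ring

lemma abs_inner2_le {x : Site} {v : ℝ × ℝ} {D M : ℝ} (hx1 : |(x.1 : ℝ)| ≤ D)
    (hx2 : |(x.2 : ℝ)| ≤ D) (hv1 : |v.1| ≤ M) (hv2 : |v.2| ≤ M) :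
    |inner2 x v| ≤ 2 * D * M := by
  have hD : 0 ≤ D := (abs_nonneg _).trans hx1
  calc |inner2 x v| ≤ |(x.1 : ℝ) * v.1| + |(x.2 : ℝ) * v.2| := abs_add_le _ _
    _ ≤ D * M + D * M := by
      rw [abs_mul, abs_mul]
      exact add_le_add (mul_le_mul hx1 hv1 (abs_nonneg _) hD)
        (mul_le_mul hx2 hv2 (abs_nonneg _) hD)
    _ = 2 * D * M := by ring

/-- The halfplane heights of a site in the directions `u`, `V`, `W`. A droplet is the set of
sites whose heights are bounded by a given triple. -/
noncomputable def heights (u V W : ℝ × ℝ) (x : Site) : ℝ × ℝ × ℝ :=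
  (inner2 x u, inner2 x V, inner2 x W)

/-- The size of the droplet with the given heights. -/
def dropletSize (d : ℝ × ℝ × ℝ) : ℝ := d.1 + d.2.1 + d.2.2

lemma dropletSize_mono {d e : ℝ × ℝ × ℝ} (h : d ≤ e) : dropletSize d ≤ dropletSize e :=
  add_le_add (add_le_add h.1 h.2.1) h.2.2

lemma dropletSize_heights {u V W : ℝ × ℝ} (h : u + V + W = 0) (x : Site) :
    dropletSize (heights u V W x) = 0 := by
  have h1 : u.1 + V.1 + W.1 = 0 := congrArg Prod.fst h
  have h2 : u.2 + V.2 + W.2 = 0 := congrArg Prod.snd h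
  simp only [dropletSize, heights, inner2]
  linear_combination (x.1 : ℝ) * h1 + (x.2 : ℝ) * h2

/-- Two sites are close if both could belong to the same translate of a rule. -/
def Close (D : ℝ) (x y : Site) : Prop :=
  |(((x - y : Site).1 : ℤ) : ℝ)| ≤ D ∧ |(((x - y : Site).2 : ℤ) : ℝ)| ≤ D

/-- The droplet spanned by two droplets containing close sites has almost additive size. -/
lemma dropletSize_sup_le {u V W : ℝ × ℝ} (h : u + V + W = 0) {D M : ℝ}
    (hu : |u.1| ≤ 1 ∧ |u.2| ≤ 1) (hV : |V.1| ≤ M ∧ |V.2| ≤ M) (hW : |W.1| ≤ M ∧ |W.2| ≤ M)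
    {d e : ℝ × ℝ × ℝ} {x y : Site} (hx : heights u V W x ≤ d) (hy : heights u V W y ≤ e)
    (hxy : Close D x y) :
    dropletSize (d ⊔ e) ≤ dropletSize d + dropletSize e + (2 * D + 4 * D * M) := by
  have key : ∀ v : ℝ × ℝ, ∀ K a b : ℝ, |v.1| ≤ K → |v.2| ≤ K → inner2 x v ≤ a →
      inner2 y v ≤ b → max a b ≤ a + b - inner2 x v + 2 * D * K := by
    intro v K a b h1 h2 ha hb
    have h3 := abs_le.1 (abs_inner2_le hxy.1 hxy.2 h1 h2)
    have h4 : inner2 x v = inner2 (x - y) v + inner2 y v := by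
      rw [← inner2_add, sub_add_cancel]
    have h5 := (abs_nonneg _).trans (abs_inner2_le hxy.1 hxy.2 h1 h2)
    exact max_le (by linarith) (by linarith)
  have k1 := key u 1 d.1 e.1 hu.1 hu.2 hx.1 hy.1
  have k2 := key V M d.2.1 e.2.1 hV.1 hV.2 hx.2.1 hy.2.1
  have k3 := key W M d.2.2 e.2.2 hW.1 hW.2 hx.2.2 hy.2.2
  have h0 : inner2 x u + inner2 x V + inner2 x W = 0 := dropletSize_heights h x
  have : dropletSize (d ⊔ e) = max d.1 e.1 + max d.2.1 e.2.1 + max d.2.2 e.2.2 := rfl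
  rw [this]
  simp only [dropletSize]
  linarith

/-- The covering algorithm: starting from a small droplet at each site of `Z`, droplets
containing close sites are merged until there are no such pairs. -/
lemma exists_separated_cover {u V W : ℝ × ℝ} (h : u + V + W = 0) {D K : ℝ} (hK : 0 ≤ K)
    (hmerge : ∀ d e x y, heights u V W x ≤ d → heights u V W y ≤ e → Close D x y →
      dropletSize (d ⊔ e) ≤ dropletSize d + dropletSize e + K) (Z : Finset Site) :
    ∃ P : Finset (ℝ × ℝ × ℝ), (∀ z ∈ Z, ∃ d ∈ P, heights u V W z ≤ d) ∧
      (∀ d ∈ P, ∃ z ∈ Z, heights u V W z ≤ d) ∧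
      (∀ d ∈ P, dropletSize d ≤ K * Z.card) ∧
      ∀ d ∈ P, ∀ e ∈ P, d ≠ e → ∀ x y, heights u V W x ≤ d → heights u V W y ≤ e →
        ¬ Close D x y := by
  let Q : Finset (ℝ × ℝ × ℝ) → Prop := fun P =>
    (∀ z ∈ Z, ∃ d ∈ P, heights u V W z ≤ d) ∧ (∀ d ∈ P, ∃ z ∈ Z, heights u V W z ≤ d) ∧
      ∑ d ∈ P, (dropletSize d + K) ≤ K * Z.card
  have hnonneg : ∀ P, Q P → ∀ d ∈ P, 0 ≤ dropletSize d := by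
    intro P hP d hd
    obtain ⟨z, -, hz⟩ := hP.2.1 d hd
    exact (dropletSize_heights h z).ge.trans (dropletSize_mono hz)
  have hQ : ∃ P, Q P := by
    refine ⟨Z.image (heights u V W), fun z hz => ⟨_, Finset.mem_image_of_mem _ hz, le_rfl⟩,
      ?_, ?_⟩
    · intro d hd
      obtain ⟨z, hz, rfl⟩ := Finset.mem_image.1 hd
      exact ⟨z, hz, le_rfl⟩
    · have : ∀ d ∈ Z.image (heights u V W), dropletSize d + K = K := by
        intro d hd
        obtain ⟨z, hz, rfl⟩ := Finset.mem_image.1 hd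
        rw [dropletSize_heights h, zero_add]
      rw [Finset.sum_congr rfl this, Finset.sum_const, nsmul_eq_mul, mul_comm]
      exact mul_le_mul_of_nonneg_left (by exact_mod_cast Finset.card_image_le) hK
  obtain ⟨P, hP, hmin⟩ := WellFounded.has_min
    (measure (Finset.card : Finset (ℝ × ℝ × ℝ) → ℕ)).wf {P | Q P} hQ
  refine ⟨P, hP.1, hP.2.1, ?_, ?_⟩
  · intro d hd
    have h1 := Finset.single_le_sum (f := fun d => dropletSize d + K)
      (fun e he => add_nonneg (hnonneg P hP e he) hK) hd
    have h2 := hP.2.2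
    linarith
  · intro d hd e he hde x y hx hy hxy
    have he' : e ∈ P.erase d := Finset.mem_erase.2 ⟨hde.symm, he⟩
    have hsub : ∀ f ∈ (P.erase d).erase e, f ∈ P :=
      fun f hf => Finset.mem_of_mem_erase (Finset.mem_of_mem_erase hf)
    have hsize := hmerge d e x y hx hy hxy
    have hsum1 := Finset.add_sum_erase P (fun d => dropletSize d + K) hd
    have hsum2 := Finset.add_sum_erase (P.erase d) (fun d => dropletSize d + K) he'
    refine hmin (insert (d ⊔ e) ((P.erase d).erase e)) ⟨?_, ?_, ?_⟩ ?_
    · intro z hz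
      obtain ⟨f, hf, hzf⟩ := hP.1 z hz
      by_cases hfd : f = d
      · exact ⟨_, Finset.mem_insert_self _ _, hzf.trans (hfd ▸ le_sup_left)⟩
      by_cases hfe : f = e
      · exact ⟨_, Finset.mem_insert_self _ _, hzf.trans (hfe ▸ le_sup_right)⟩
      · exact ⟨f, Finset.mem_insert_of_mem
          (Finset.mem_erase.2 ⟨hfe, Finset.mem_erase.2 ⟨hfd, hf⟩⟩), hzf⟩
    · intro f hf
      rcases Finset.mem_insert.1 hf with rfl | hf
      · obtain ⟨z, hz, hzd⟩ := hP.2.1 d hd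
        exact ⟨z, hz, hzd.trans le_sup_left⟩
      · exact hP.2.1 f (hsub f hf)
    · have hle : ∑ f ∈ insert (d ⊔ e) ((P.erase d).erase e), (dropletSize f + K) ≤
          (dropletSize (d ⊔ e) + K) + ∑ f ∈ (P.erase d).erase e, (dropletSize f + K) := by
        by_cases hm : d ⊔ e ∈ (P.erase d).erase e
        · rw [Finset.insert_eq_of_mem hm]
          linarith [hnonneg P hP _ (hsub _ hm)]
        · rw [Finset.sum_insert hm]
      linarith [hP.2.2]
    · change Finset.card _ < Finset.card _
      have h1 := Finset.card_insert_le (d ⊔ e) ((P.erase d).erase e)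
      have h2 := Finset.card_erase_add_one he'
      have h3 := Finset.card_erase_add_one hd
      omega

/-- A separated union of droplets with stable sides is closed under the dynamics. -/
lemma bpClosure_subset_of_separated {𝒰 : Finset (Finset Site)} (h𝒰 : IsUpdateFamily 𝒰)
    {u V W : ℝ × ℝ} (hu : ¬ Unstable 𝒰 u) (hV : ¬ Unstable 𝒰 V) (hW : ¬ Unstable 𝒰 W)
    {P : Finset (ℝ × ℝ × ℝ)} {Z : Set Site} (hZ : ∀ z ∈ Z, ∃ d ∈ P, heights u V W z ≤ d)
    (hsep : ∀ d ∈ P, ∀ e ∈ P, d ≠ e → ∀ x y, heights u V W x ≤ d → heights u V W y ≤ e →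
      ¬ Close (famDiam 𝒰) x y) :
    ∀ z ∈ bpClosure 𝒰 Z, ∃ d ∈ P, heights u V W z ≤ d := by
  intro z hz
  obtain ⟨n, hn⟩ := Set.mem_iUnion.1 hz
  clear hz
  induction n generalizing z with
  | zero => exact hZ z hn
  | succ n ih =>
    rcases hn with hn | ⟨U, hU, hn⟩
    · exact ih z hn
    obtain ⟨y₀, hy₀⟩ := (h𝒰.2 U hU).1
    obtain ⟨d, hd, hyd⟩ := ih _ (hn y₀ hy₀)
    have hall : ∀ y ∈ U, heights u V W (z + y) ≤ d := by
      intro y hy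
      obtain ⟨e, he, hye⟩ := ih _ (hn y hy)
      by_cases hde : d = e
      · rwa [hde]
      refine absurd ?_ (hsep d hd e he hde _ _ hyd hye)
      have h1 := abs_le_of_mem_rule hU hy₀
      have h2 := abs_le_of_mem_rule hU hy
      rw [Close, add_sub_add_left_eq_sub, Prod.fst_sub, Prod.snd_sub, Int.cast_sub, Int.cast_sub]
      exact ⟨(abs_sub _ _).trans (by linarith), (abs_sub _ _).trans (by linarith)⟩
    have key : ∀ v : ℝ × ℝ, ∀ c : ℝ, ¬ Unstable 𝒰 v → (∀ y ∈ U, inner2 (z + y) v ≤ c) →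
        inner2 z v ≤ c := by
      intro v c hv hc
      by_contra! hlt
      refine hv ⟨U, hU, fun y hy => ?_⟩
      have := hc y hy
      rw [inner2_add] at this
      change inner2 y v < 0
      linarith
    exact ⟨d, hd, key u _ hu fun y hy => (hall y hy).1, key V _ hV fun y hy => (hall y hy).2.1,
      key W _ hW fun y hy => (hall y hy).2.2⟩

/-- there is a universal constant `C > 0` such that for every
critical update family with diameter `D`, every isolated stable direction `u`
and every set `Z ⊆ {x : ⟨x,u⟩ > 0}` of cardinality at most `D`, every point of
the closure `[Z]` satisfies `⟨z,u⟩ ≥ −C·D⁴`. -/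
theorem covering_algorithm_bound :
    ∃ C : ℝ, 0 < C ∧
      ∀ (𝒰 : Finset (Finset Site)), IsUpdateFamily 𝒰 → Critical 𝒰 →
        ∀ u : ℝ × ℝ, IsolatedStable 𝒰 u →
          ∀ Z : Finset Site, (∀ z ∈ Z, 0 < inner2 z u) → Z.card ≤ famDiam 𝒰 →
            ∀ z ∈ bpClosure 𝒰 (Z : Set Site),
              -(C * (famDiam 𝒰 : ℝ) ^ 4) ≤ inner2 z u := by
  refine ⟨6, by norm_num, fun 𝒰 h𝒰 hcrit u hu Z hZ hcard z hz => ?_⟩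
  obtain ⟨V, W, hV, hW, hsum, hVb, hWb⟩ := exists_balancing h𝒰 hcrit.1 hu.1
  have hub := abs_le_one_of_mem_sphere2 hu.1.1
  set D : ℝ := (famDiam 𝒰 : ℝ) with hD
  have hD0 : 0 ≤ D := Nat.cast_nonneg _
  have hDD : D ≤ D ^ 3 := by
    rw [hD]; exact_mod_cast Nat.le_self_pow (by norm_num) (famDiam 𝒰)
  obtain ⟨P, hcov, hmem, hsize, hsep⟩ := exists_separated_cover hsum
    (K := 6 * D ^ 3) (D := D) (by positivity)
    (fun d e x y hx hy hxy => (dropletSize_sup_le hsum hub hVb hWb hx hy hxy).trans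
      (by nlinarith)) Z
  obtain ⟨d, hd, hzd⟩ := bpClosure_subset_of_separated h𝒰 hu.1.2 hV hW hcov hsep z hz
  obtain ⟨y, hy, hyd⟩ := hmem d hd
  have h0 : inner2 z u + inner2 z V + inner2 z W = 0 := dropletSize_heights hsum z
  have h1 : inner2 z V ≤ d.2.1 := hzd.2.1
  have h2 : inner2 z W ≤ d.2.2 := hzd.2.2
  have h3 : inner2 y u ≤ d.1 := hyd.1
  have h4 := hZ y hy
  have h5 : d.1 + d.2.1 + d.2.2 ≤ 6 * D ^ 3 * Z.card := hsize d hd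
  have h6 : 6 * D ^ 3 * Z.card ≤ 6 * D ^ 3 * D :=
    mul_le_mul_of_nonneg_left (by rw [hD]; exact_mod_cast hcard) (by positivity)
  have h7 : 6 * D ^ 3 * D = 6 * D ^ 4 := by ring
  linarith
end

section
/- Let 𝒰 be a critical update family with diameter D and let u be an isolated stable direction of 𝒰. Then there exists a set 𝒯 of three or four stable directions of 𝒰 with u ∈ 𝒯 such that: (i) the origin of ℝ² lies in the convex hull of 𝒯 (viewing directions as unit vectors in ℝ²); (ii) for each v ∈ 𝒯 there exists a nonzero x ∈ ℤ² ∩ ℝv with ‖x‖_∞ ≤ D/2; and (iii) the angular gap between any two cyclically consecutive elements of 𝒯 on the circle S¹ is at most π − 2/D². -/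
open scoped Classical

/-- The planar cross product of two vectors. -/
def cross2 (p q : ℝ × ℝ) : ℝ := p.1 * q.2 - p.2 * q.1

/-- The stable directions spanned by a nonzero lattice vector of sup-norm at most `D/2`. -/
def shortStable (𝒰 : Finset (Finset Site)) : Set (ℝ × ℝ) :=
  {v | Stable 𝒰 v ∧ ∃ x : Site, x ≠ (0, 0) ∧ (∃ t : ℝ, ((x.1 : ℝ), (x.2 : ℝ)) = t • v) ∧
    ((max x.1.natAbs x.2.natAbs : ℕ) : ℝ) ≤ (famDiam 𝒰 : ℝ) / 2}

lemma unstable_smul {𝒰 : Finset (Finset Site)} {u : ℝ × ℝ} {c : ℝ} (hc : 0 < c)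
    (h : Unstable 𝒰 (c • u)) : Unstable 𝒰 u := by
  obtain ⟨U, hU, hx⟩ := h
  refine ⟨U, hU, fun x hxU => ?_⟩
  have h1 : inner2 x (c • u) < 0 := hx hxU
  have h2 : inner2 x (c • u) = c * inner2 x u := by simp [inner2]; ring
  rw [h2] at h1
  exact neg_of_mul_neg_right h1 hc.le

lemma isOpen_unstable (𝒰 : Finset (Finset Site)) : IsOpen {z | Unstable 𝒰 z} := by
  have : {z | Unstable 𝒰 z} = ⋃ U ∈ 𝒰, ⋂ x ∈ U, {z | inner2 x z < 0} := by
    ext z; simp [Unstable, halfPlane, Set.subset_def]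
  rw [this]
  exact isOpen_biUnion fun U _ => isOpen_biInter_finset fun x _ =>
    isOpen_lt (continuous_inner2 x) continuous_const

/-- Every rule has an element strictly on the positive side of `z`. -/
def StrictlyStable (𝒰 : Finset (Finset Site)) (z : ℝ × ℝ) : Prop :=
  ∀ U ∈ 𝒰, ∃ x ∈ U, 0 < inner2 x z

lemma isOpen_strictlyStable (𝒰 : Finset (Finset Site)) :
    IsOpen {z | StrictlyStable 𝒰 z} := by
  have : {z | StrictlyStable 𝒰 z} = ⋂ U ∈ 𝒰, ⋃ x ∈ U, {z | 0 < inner2 x z} := by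
    ext z; simp [StrictlyStable]
  rw [this]
  exact isOpen_biInter_finset fun U _ => isOpen_biUnion fun x _ =>
    isOpen_lt continuous_const (continuous_inner2 x)

lemma StrictlyStable.not_unstable {𝒰 : Finset (Finset Site)} {z : ℝ × ℝ}
    (h : StrictlyStable 𝒰 z) : ¬ Unstable 𝒰 z := by
  rintro ⟨U, hU, hx⟩
  obtain ⟨x, hxU, h1⟩ := h U hU
  have h2 : inner2 x z < 0 := hx hxU
  linarith

lemma exists_inner2_eq_zero {𝒰 : Finset (Finset Site)} {z : ℝ × ℝ} (h : ¬ Unstable 𝒰 z)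
    (h' : ¬ StrictlyStable 𝒰 z) : ∃ U ∈ 𝒰, ∃ x ∈ U, inner2 x z = 0 := by
  unfold StrictlyStable at h'
  push Not at h'
  obtain ⟨U, hU, hle⟩ := h'
  have : ¬ (U : Set Site) ⊆ halfPlane z := fun hs => h ⟨U, hU, hs⟩
  obtain ⟨x, hxU, hx⟩ := Set.not_subset.1 this
  exact ⟨U, hU, x, hxU, le_antisymm (hle x hxU) (not_lt.1 hx)⟩

lemma two_mul_natAbs_le_famDiam {𝒰 : Finset (Finset Site)} {U : Finset Site} (hU : U ∈ 𝒰)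
    {x : Site} (hx : x ∈ U) : 2 * max x.1.natAbs x.2.natAbs ≤ famDiam 𝒰 :=
  Nat.mul_le_mul_left 2 <|
    (Finset.le_sup (f := fun x : Site => max x.1.natAbs x.2.natAbs) hx).trans
      (Finset.le_sup (f := fun U : Finset Site =>
        U.sup fun x : Site => max x.1.natAbs x.2.natAbs) hU)

lemma mem_shortStable_of_inner2_eq_zero {𝒰 : Finset (Finset Site)} (h𝒰 : IsUpdateFamily 𝒰)
    {v : ℝ × ℝ} (hv : Stable 𝒰 v) {U : Finset Site} (hU : U ∈ 𝒰) {x : Site} (hx : x ∈ U)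
    (h0 : inner2 x v = 0) : v ∈ shortStable 𝒰 := by
  have hs : v.1 ^ 2 + v.2 ^ 2 = 1 := hv.1
  simp only [inner2] at h0
  refine ⟨hv, (-x.2, x.1), ?_, ⟨-x.2 * v.1 + x.1 * v.2, ?_⟩, ?_⟩
  · intro h
    apply (h𝒰.2 U hU).2
    have : x = (0, 0) := by
      simp only [Prod.mk.injEq, neg_eq_zero] at h
      exact Prod.ext h.2 h.1
    rwa [← this]
  · ext
    · simp only [Prod.smul_fst, smul_eq_mul, Int.cast_neg]
      linear_combination (x.2 : ℝ) * hs - v.2 * h0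
    · simp only [Prod.smul_snd, smul_eq_mul]
      linear_combination (-x.1 : ℝ) * hs + v.1 * h0
  · have h := two_mul_natAbs_le_famDiam hU hx
    have h' : (2 : ℝ) * ((max x.1.natAbs x.2.natAbs : ℕ) : ℝ) ≤ famDiam 𝒰 := by
      exact_mod_cast h
    rw [Int.natAbs_neg, max_comm]
    linarith

lemma neg_mem_shortStable {𝒰 : Finset (Finset Site)} {v : ℝ × ℝ} (hv : v ∈ shortStable 𝒰)
    (h : Stable 𝒰 (-v)) : -v ∈ shortStable 𝒰 := by
  obtain ⟨-, x, hx, ⟨t, ht⟩, hD⟩ := hv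
  exact ⟨h, x, hx, ⟨-t, by simpa using ht⟩, hD⟩

lemma finite_shortStable (𝒰 : Finset (Finset Site)) : (shortStable 𝒰).Finite := by
  set D : ℤ := (famDiam 𝒰 : ℤ)
  let B : Finset (Site × ℝ) := (Finset.Icc (-D) D ×ˢ Finset.Icc (-D) D) ×ˢ {1, -1}
  refine (B.finite_toSet.image fun y =>
    (y.2 / √((y.1.1 : ℝ) ^ 2 + (y.1.2 : ℝ) ^ 2)) • ((y.1.1 : ℝ), (y.1.2 : ℝ))).subset ?_
  rintro v ⟨⟨hs, -⟩, x, hx, ⟨t, ht⟩, hD⟩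
  replace hs : v.1 ^ 2 + v.2 ^ 2 = 1 := hs
  have hD' : max x.1.natAbs x.2.natAbs ≤ famDiam 𝒰 := by
    have h0 : (0 : ℝ) ≤ famDiam 𝒰 := Nat.cast_nonneg _
    have : ((max x.1.natAbs x.2.natAbs : ℕ) : ℝ) ≤ famDiam 𝒰 := by linarith
    exact_mod_cast this
  have h1 : (x.1 : ℝ) = t * v.1 := congrArg Prod.fst ht
  have h2 : (x.2 : ℝ) = t * v.2 := congrArg Prod.snd ht
  have ht0 : t ≠ 0 := by
    rintro rfl
    apply hx
    simp only [zero_mul, Int.cast_eq_zero] at h1 h2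
    exact Prod.ext h1 h2
  have hN : √((x.1 : ℝ) ^ 2 + (x.2 : ℝ) ^ 2) = |t| := by
    rw [← Real.sqrt_sq_eq_abs]
    congr 1
    rw [h1, h2]
    linear_combination t ^ 2 * hs
  have hmem : ∀ σ : ℝ, σ = 1 ∨ σ = -1 → (x, σ) ∈ B := by
    intro σ hσ
    simp only [B, Finset.mem_product, Finset.mem_Icc, Finset.mem_insert, Finset.mem_singleton]
    exact ⟨by omega, hσ⟩
  rcases lt_or_gt_of_ne ht0 with h | h
  · refine ⟨(x, -1), hmem _ (Or.inr rfl), ?_⟩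
    simp only [hN, ht, smul_smul, abs_of_neg h]
    rw [neg_div_neg_eq, one_div, inv_mul_cancel₀ ht0, one_smul]
  · refine ⟨(x, 1), hmem _ (Or.inl rfl), ?_⟩
    simp only [hN, ht, smul_smul, abs_of_pos h]
    rw [one_div, inv_mul_cancel₀ ht0, one_smul]

lemma IsolatedStable.not_eventually {𝒰 : Finset (Finset Site)} {u : ℝ × ℝ}
    (hu : IsolatedStable 𝒰 u) {σ : ℝ} (hσ : σ ^ 2 = 1)
    (h : ∀ᶠ θ in nhdsWithin (0 : ℝ) (Set.Ioi 0), ¬ Unstable 𝒰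
      (Real.cos θ * u.1 - Real.sin θ * (σ * u.2), Real.cos θ * u.2 + Real.sin θ * (σ * u.1))) :
    False := by
  have hs : u.1 ^ 2 + u.2 ^ 2 = 1 := hu.1.1
  refine hu.2 (mem_closure_of_tendsto (b := nhdsWithin (0 : ℝ) (Set.Ioi 0)) (f := fun θ : ℝ =>
      (Real.cos θ * u.1 - Real.sin θ * (σ * u.2), Real.cos θ * u.2 + Real.sin θ * (σ * u.1)))
      ?_ ?_)
  · have hcont : Continuous (fun θ : ℝ => (Real.cos θ * u.1 - Real.sin θ * (σ * u.2),
        Real.cos θ * u.2 + Real.sin θ * (σ * u.1))) := by fun_prop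
    have := (hcont.tendsto 0).mono_left (nhdsWithin_le_nhds (s := Set.Ioi (0 : ℝ)))
    simpa using this
  · filter_upwards [h, Ioo_mem_nhdsGT Real.pi_pos] with θ hθ hθ'
    refine ⟨⟨?_, hθ⟩, fun heq => ?_⟩
    · change (_ : ℝ) ^ 2 + _ ^ 2 = 1
      linear_combination (Real.cos θ ^ 2 + σ ^ 2 * Real.sin θ ^ 2) * hs + Real.sin θ ^ 2 * hσ +
        Real.sin_sq_add_cos_sq θ
    · have hsin := Real.sin_pos_of_pos_of_lt_pi hθ'.1 hθ'.2
      have heq' := Set.mem_singleton_iff.1 heq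
      have e1 : Real.cos θ * u.1 - Real.sin θ * (σ * u.2) = u.1 := congrArg Prod.fst heq'
      have e2 : Real.cos θ * u.2 + Real.sin θ * (σ * u.1) = u.2 := congrArg Prod.snd heq'
      have : Real.sin θ * σ = 0 := by
        linear_combination u.1 * e2 - u.2 * e1 - Real.sin θ * σ * hs
      rcases mul_eq_zero.1 this with h | h
      · exact hsin.ne' h
      · rw [h] at hσ; norm_num at hσ

lemma IsolatedStable.mem_shortStable {𝒰 : Finset (Finset Site)} (h𝒰 : IsUpdateFamily 𝒰)
    {u : ℝ × ℝ} (hu : IsolatedStable 𝒰 u) : u ∈ shortStable 𝒰 := by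
  by_cases h : StrictlyStable 𝒰 u
  · exfalso
    refine hu.not_eventually (σ := 1) (by norm_num) ?_
    have hcont : Continuous (fun θ : ℝ => (Real.cos θ * u.1 - Real.sin θ * (1 * u.2),
        Real.cos θ * u.2 + Real.sin θ * (1 * u.1))) := by fun_prop
    have ht : Filter.Tendsto _ (nhdsWithin (0 : ℝ) (Set.Ioi 0)) _ :=
      (hcont.tendsto 0).mono_left nhdsWithin_le_nhds
    refine (ht.eventually ((isOpen_strictlyStable 𝒰).mem_nhds ?_)).mono
      fun θ hθ => StrictlyStable.not_unstable hθ
    simpa using h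
  · obtain ⟨U, hU, x, hx, h0⟩ := exists_inner2_eq_zero hu.1.2 h
    exact mem_shortStable_of_inner2_eq_zero h𝒰 hu.1 hU hx h0

lemma exists_shortStable_mem_openSemicircle {𝒰 : Finset (Finset Site)} (h𝒰 : IsUpdateFamily 𝒰)
    (hc : ¬ Supercritical 𝒰) {u : ℝ × ℝ} (hu : IsolatedStable 𝒰 u) {m : ℝ × ℝ}
    (hm : m ∈ sphere2) : ∃ v ∈ shortStable 𝒰, 0 < v.1 * m.1 + v.2 * m.2 := by
  by_contra! hno
  set K : Set (ℝ × ℝ) := {z | 0 < z.1 * m.1 + z.2 * m.2} with hK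
  have hnorm : ∀ z ∈ K, ∃ c : ℝ, 0 < c ∧ c • z ∈ sphere2 := by
    intro z hz
    have hpos : 0 < z.1 ^ 2 + z.2 ^ 2 := by
      by_contra! hle
      have h1 : z.1 = 0 := by nlinarith [sq_nonneg z.1, sq_nonneg z.2]
      have h2 : z.2 = 0 := by nlinarith [sq_nonneg z.1, sq_nonneg z.2]
      simp [hK, h1, h2] at hz
    refine ⟨(√(z.1 ^ 2 + z.2 ^ 2))⁻¹, inv_pos.2 (Real.sqrt_pos.2 hpos), ?_⟩
    change ((√(z.1 ^ 2 + z.2 ^ 2))⁻¹ * z.1) ^ 2 + ((√(z.1 ^ 2 + z.2 ^ 2))⁻¹ * z.2) ^ 2 = 1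
    rw [mul_pow, mul_pow, inv_pow, Real.sq_sqrt hpos.le, ← mul_add, inv_mul_cancel₀ hpos.ne']
  have hcover : K ⊆ {z | StrictlyStable 𝒰 z} ∪ {z | Unstable 𝒰 z} := by
    intro z hz
    by_contra hcon
    simp only [Set.mem_union, Set.mem_ofPred_eq, not_or] at hcon
    obtain ⟨U, hU, x, hx, h0⟩ := exists_inner2_eq_zero hcon.2 hcon.1
    obtain ⟨c, hc0, hcs⟩ := hnorm z hz
    have hst : Stable 𝒰 (c • z) := ⟨hcs, fun h => hcon.2 (unstable_smul hc0 h)⟩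
    have := hno _ (mem_shortStable_of_inner2_eq_zero h𝒰 hst hU hx (by
      have : inner2 x (c • z) = c * inner2 x z := by simp [inner2]; ring
      rw [this, h0, mul_zero]))
    have h2 : 0 < c * (z.1 * m.1 + z.2 * m.2) := mul_pos hc0 hz
    simp only [Prod.smul_fst, Prod.smul_snd, smul_eq_mul] at this
    nlinarith
  have hconv : Convex ℝ K := by
    intro p hp q hq a b ha hb hab
    simp only [hK, Set.mem_ofPred_eq, Prod.fst_add, Prod.snd_add, Prod.smul_fst, Prod.smul_snd,
      smul_eq_mul] at *
    have : (a * p.1 + b * q.1) * m.1 + (a * p.2 + b * q.2) * m.2 =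
      a * (p.1 * m.1 + p.2 * m.2) + b * (q.1 * m.1 + q.2 * m.2) := by ring
    rw [this]
    rcases ha.lt_or_eq with h | h
    · have := mul_pos h hp; have := mul_nonneg hb hq.le; linarith
    · subst h; rw [zero_add] at hab; subst hab; linarith
  have hstable : ∀ z ∈ K, ¬ Unstable 𝒰 z := by
    intro w hw hwu
    have : ∃ v ∈ openSemicircle m, ¬ Unstable 𝒰 v := by
      by_contra! h
      exact hc ⟨m, hm, h⟩
    obtain ⟨v, hv, hvs⟩ := this
    have hvK : v ∈ K := hv.2
    obtain ⟨z, -, hz1, hz2⟩ := hconv.isPreconnected _ _ (isOpen_strictlyStable 𝒰)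
      (isOpen_unstable 𝒰) hcover ⟨v, hvK, (hcover hvK).resolve_right hvs⟩ ⟨w, hw, hwu⟩
    exact StrictlyStable.not_unstable hz1 hz2
  have hs : u.1 ^ 2 + u.2 ^ 2 = 1 := hu.1.1
  have hms : m.1 ^ 2 + m.2 ^ 2 = 1 := hm
  rcases lt_or_ge (u.1 * m.1 + u.2 * m.2) 0 with h | h
  · have hK' : -u ∈ K := by
      simp only [hK, Set.mem_ofPred_eq, Prod.fst_neg, Prod.snd_neg]
      linarith
    have hns : Stable 𝒰 (-u) := ⟨by simpa [sphere2] using hs, hstable _ hK'⟩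
    exact absurd hK' (not_lt.2 (hno _ (neg_mem_shortStable (hu.mem_shortStable h𝒰) hns)))
  · have hσ : ∃ σ : ℝ, σ ^ 2 = 1 ∧ 0 ≤ σ * (u.1 * m.2 - u.2 * m.1) := by
      rcases le_total 0 (u.1 * m.2 - u.2 * m.1) with h' | h'
      · exact ⟨1, by norm_num, by linarith⟩
      · exact ⟨-1, by norm_num, by linarith⟩
    obtain ⟨σ, hσ, hb⟩ := hσ
    refine hu.not_eventually hσ ?_
    filter_upwards [Ioo_mem_nhdsGT Real.pi_div_two_pos] with θ hθ
    apply hstable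
    have hsin : 0 < Real.sin θ :=
      Real.sin_pos_of_pos_of_lt_pi hθ.1 (by linarith [hθ.2, Real.pi_pos])
    have hcos : 0 < Real.cos θ := Real.cos_pos_of_mem_Ioo ⟨by linarith [hθ.1, Real.pi_pos], hθ.2⟩
    change 0 < (Real.cos θ * u.1 - Real.sin θ * (σ * u.2)) * m.1 +
      (Real.cos θ * u.2 + Real.sin θ * (σ * u.1)) * m.2
    have e : (Real.cos θ * u.1 - Real.sin θ * (σ * u.2)) * m.1 +
        (Real.cos θ * u.2 + Real.sin θ * (σ * u.1)) * m.2 =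
        Real.cos θ * (u.1 * m.1 + u.2 * m.2) + Real.sin θ * (σ * (u.1 * m.2 - u.2 * m.1)) := by
      ring
    rw [e]
    have hsq : (u.1 * m.1 + u.2 * m.2) ^ 2 + (σ * (u.1 * m.2 - u.2 * m.1)) ^ 2 = 1 := by
      linear_combination (u.1 * m.2 - u.2 * m.1) ^ 2 * hσ + (m.1 ^ 2 + m.2 ^ 2) * hs + hms
    rcases h.lt_or_eq with h' | h'
    · have := mul_pos hcos h'; have := mul_nonneg hsin.le hb; linarith
    · rw [← h'] at hsq ⊢
      have : 0 < σ * (u.1 * m.2 - u.2 * m.1) :=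
        hb.lt_of_ne (by rintro h0; rw [← h0] at hsq; norm_num at hsq)
      have := mul_pos hsin this
      linarith

lemma shortStable.two_le_famDiam {𝒰 : Finset (Finset Site)} {v : ℝ × ℝ}
    (hv : v ∈ shortStable 𝒰) : (2 : ℝ) ≤ famDiam 𝒰 := by
  obtain ⟨-, x, hx, -, hD⟩ := hv
  have : 1 ≤ max x.1.natAbs x.2.natAbs := by
    by_contra! h
    exact hx (Prod.ext (by simp only; omega) (by simp only; omega))
  have : (1 : ℝ) ≤ ((max x.1.natAbs x.2.natAbs : ℕ) : ℝ) := by exact_mod_cast this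
  linarith

lemma shortStable.two_div_sq_le_cross2 {𝒰 : Finset (Finset Site)} {p q : ℝ × ℝ}
    (hp : p ∈ shortStable 𝒰) (hq : q ∈ shortStable 𝒰) (hpq : 0 < cross2 p q) :
    2 / (famDiam 𝒰 : ℝ) ^ 2 ≤ cross2 p q := by
  have hD2 := shortStable.two_le_famDiam hp
  set D : ℝ := (famDiam 𝒰 : ℝ)
  have key : ∀ v ∈ shortStable 𝒰, ∃ x : Site, ∃ t : ℝ, t ≠ 0 ∧ (x.1 : ℝ) = t * v.1 ∧
      (x.2 : ℝ) = t * v.2 ∧ t ^ 2 ≤ D ^ 2 / 2 := by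
    rintro v ⟨⟨hs, -⟩, x, hx, ⟨t, ht⟩, hD⟩
    replace hs : v.1 ^ 2 + v.2 ^ 2 = 1 := hs
    have h1 : (x.1 : ℝ) = t * v.1 := congrArg Prod.fst ht
    have h2 : (x.2 : ℝ) = t * v.2 := congrArg Prod.snd ht
    refine ⟨x, t, ?_, h1, h2, ?_⟩
    · rintro rfl
      apply hx
      simp only [zero_mul, Int.cast_eq_zero] at h1 h2
      exact Prod.ext h1 h2
    · have hN : t ^ 2 = (x.1 : ℝ) ^ 2 + (x.2 : ℝ) ^ 2 := by
        rw [h1, h2]; linear_combination -t ^ 2 * hs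
      rw [Nat.cast_max, max_le_iff, Nat.cast_natAbs, Nat.cast_natAbs, Int.cast_abs,
        Int.cast_abs] at hD
      have a1 := sq_le_sq' (by linarith [abs_nonneg (x.1 : ℝ)]) hD.1
      have a2 := sq_le_sq' (by linarith [abs_nonneg (x.2 : ℝ)]) hD.2
      rw [sq_abs] at a1 a2
      linarith
  obtain ⟨x, s, hs0, hx1, hx2, hs⟩ := key p hp
  obtain ⟨y, t, ht0, hy1, hy2, ht⟩ := key q hq
  have hcr : ((x.1 * y.2 - x.2 * y.1 : ℤ) : ℝ) = s * t * cross2 p q := by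
    push_cast; rw [hx1, hx2, hy1, hy2, cross2]; ring
  have hne : x.1 * y.2 - x.2 * y.1 ≠ 0 := by
    intro h0
    rw [h0, Int.cast_zero] at hcr
    exact mul_ne_zero (mul_ne_zero hs0 ht0) hpq.ne' hcr.symm
  have h1 : (1 : ℝ) ≤ |((x.1 * y.2 - x.2 * y.1 : ℤ) : ℝ)| := by
    exact_mod_cast Int.one_le_abs hne
  rw [hcr, abs_mul, abs_of_pos hpq] at h1
  have h2 : |s * t| ≤ D ^ 2 / 2 := by
    apply abs_le_of_sq_le_sq _ (by positivity)
    rw [mul_pow, sq (D ^ 2 / 2)]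
    gcongr
  rw [div_le_iff₀ (by positivity)]
  nlinarith

lemma shortStable.cos_le_of_mem_cone {𝒰 : Finset (Finset Site)} {p q w : ℝ × ℝ}
    (hp : p ∈ shortStable 𝒰) (hq : q ∈ shortStable 𝒰) (hpq : 0 < cross2 p q)
    (hw : w ∈ sphere2) (hpw : 0 ≤ cross2 p w) (hwq : cross2 q w ≤ 0) :
    Real.cos ((Real.pi - 2 / (famDiam 𝒰 : ℝ) ^ 2) / 2) ≤ p.1 * w.1 + p.2 * w.2 ∨
    Real.cos ((Real.pi - 2 / (famDiam 𝒰 : ℝ) ^ 2) / 2) ≤ q.1 * w.1 + q.2 * w.2 := by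
  have hD2 := shortStable.two_le_famDiam hp
  have hδ := shortStable.two_div_sq_le_cross2 hp hq hpq
  have hδ0 : 0 < 2 / (famDiam 𝒰 : ℝ) ^ 2 := by positivity
  have hδ1 : 2 / (famDiam 𝒰 : ℝ) ^ 2 ≤ 1 := by
    rw [div_le_one (by positivity)]; nlinarith
  set δ := 2 / (famDiam 𝒰 : ℝ) ^ 2
  have hps : p.1 ^ 2 + p.2 ^ 2 = 1 := hp.1.1
  have hqs : q.1 ^ 2 + q.2 ^ 2 = 1 := hq.1.1
  have hws : w.1 ^ 2 + w.2 ^ 2 = 1 := hw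
  set c := p.1 * q.1 + p.2 * q.2 with hc
  have hcs : c ^ 2 + cross2 p q ^ 2 = 1 := by
    rw [hc, cross2]; linear_combination (q.1 ^ 2 + q.2 ^ 2) * hps + hqs
  have hcos0 : 0 < Real.cos δ :=
    Real.cos_pos_of_mem_Ioo ⟨by linarith [Real.pi_pos], by linarith [Real.pi_gt_three]⟩
  have hsin0 : 0 < Real.sin δ :=
    Real.sin_pos_of_pos_of_lt_pi hδ0 (by linarith [Real.pi_gt_three])
  have hsinδ : Real.sin δ ≤ cross2 p q := (Real.sin_le hδ0.le).trans hδ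
  have hcδ : -c ≤ Real.cos δ := by
    apply le_of_sq_le_sq _ hcos0.le
    nlinarith [Real.sin_sq_add_cos_sq δ]
  have hhalf : Real.cos ((Real.pi - δ) / 2) ^ 2 ≤ (1 + c) / 2 := by
    rw [Real.cos_sq, mul_div_cancel₀ _ two_ne_zero, Real.cos_pi_sub]
    linarith
  have hc1 : c ≤ 1 := by nlinarith [sq_nonneg (cross2 p q)]
  have hc2 : -1 ≤ c := by nlinarith [sq_nonneg (cross2 p q)]
  obtain ⟨s, t, hs, ht, hw1, hw2⟩ : ∃ s t : ℝ, 0 ≤ s ∧ 0 ≤ t ∧ w.1 = s * p.1 + t * q.1 ∧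
      w.2 = s * p.2 + t * q.2 := by
    refine ⟨-cross2 q w / cross2 p q, cross2 p w / cross2 p q,
      div_nonneg (by linarith) hpq.le, div_nonneg hpw hpq.le, ?_, ?_⟩
    all_goals
      rw [div_mul_eq_mul_div, div_mul_eq_mul_div, ← add_div, eq_div_iff hpq.ne']
      simp only [cross2]
      ring
  have hst : s ^ 2 + t ^ 2 + 2 * s * t * c = 1 := by
    rw [hw1, hw2] at hws
    rw [hc]
    linear_combination hws - s ^ 2 * hps - t ^ 2 * hqs
  have hpw' : p.1 * w.1 + p.2 * w.2 = s + t * c := by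
    rw [hw1, hw2, hc]; linear_combination s * hps
  have hqw' : q.1 * w.1 + q.2 * w.2 = t + s * c := by
    rw [hw1, hw2, hc]; linear_combination t * hqs
  have bound : ∀ a b : ℝ, 0 ≤ b → b ≤ a → a ^ 2 + b ^ 2 + 2 * a * b * c = 1 →
      Real.cos ((Real.pi - δ) / 2) ≤ a + b * c := by
    intro a b hb hab h1
    apply le_of_sq_le_sq _ (by nlinarith)
    refine hhalf.trans ?_
    have hfac : 0 ≤ (1 - c) * ((a - b) * (a + b + 2 * b * c)) :=
      mul_nonneg (by linarith) (mul_nonneg (by linarith) (by nlinarith))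
    linear_combination (1 / 2) * hfac - (1 + c) / 2 * h1
  rcases le_total t s with h | h
  · left
    rw [hpw']
    exact bound s t ht h hst
  · right
    rw [hqw']
    exact bound t s hs h (by linear_combination hst)

/-- for a critical family with diameter `D` and an isolated stable
direction `u`, there is a set `𝒯` of three or four stable directions containing
`u` such that (i) the origin lies in the convex hull of `𝒯`; (ii) each `v ∈ 𝒯`
is a rational direction witnessed by a nonzero lattice vector of sup-norm at
most `D/2`; and (iii) all cyclic gaps between consecutive elements of `𝒯` are at
most `π − 2/D²`.  Condition (iii) is expressed equivalently: every closed arc of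
angular length `π − 2/D²` (i.e. the set of unit vectors `v` with
`⟨v,w⟩ ≥ cos((π − 2/D²)/2)` for some unit vector `w`) meets `𝒯`. -/
theorem exists_direction_set (𝒰 : Finset (Finset Site)) (h𝒰 : IsUpdateFamily 𝒰)
    (hc : Critical 𝒰) (u : ℝ × ℝ) (hu : IsolatedStable 𝒰 u) :
    ∃ 𝒯 : Finset (ℝ × ℝ),
      u ∈ 𝒯 ∧ (𝒯.card = 3 ∨ 𝒯.card = 4) ∧ (∀ v ∈ 𝒯, Stable 𝒰 v) ∧
      (0 : ℝ × ℝ) ∈ convexHull ℝ (𝒯 : Set (ℝ × ℝ)) ∧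
      (∀ v ∈ 𝒯, ∃ x : Site, x ≠ (0, 0) ∧ (∃ t : ℝ, ((x.1 : ℝ), (x.2 : ℝ)) = t • v) ∧
        ((max x.1.natAbs x.2.natAbs : ℕ) : ℝ) ≤ (famDiam 𝒰 : ℝ) / 2) ∧
      (∀ w ∈ sphere2, ∃ v ∈ 𝒯,
        Real.cos ((Real.pi - 2 / (famDiam 𝒰 : ℝ) ^ 2) / 2) ≤ v.1 * w.1 + v.2 * w.2) := by
  have huE := hu.mem_shortStable h𝒰
  have hus : u.1 ^ 2 + u.2 ^ 2 = 1 := hu.1.1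
  have left : ∀ v ∈ sphere2, ∃ a ∈ shortStable 𝒰, 0 < cross2 v a := by
    intro v hv
    have hv' : v.1 ^ 2 + v.2 ^ 2 = 1 := hv
    obtain ⟨a, ha, h⟩ := exists_shortStable_mem_openSemicircle h𝒰 hc.1 hu (m := (-v.2, v.1))
      (by change (-v.2) ^ 2 + v.1 ^ 2 = 1; linarith)
    exact ⟨a, ha, by simp only at h; unfold cross2; linarith⟩
  by_cases hneg : -u ∈ shortStable 𝒰
  · obtain ⟨a, ha, hua⟩ := left u hu.1.1
    obtain ⟨b, hb, hub⟩ := left (-u) hneg.1.1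
    have hau : 0 < cross2 a (-u) := by simpa [cross2, add_comm, mul_comm, sub_eq_add_neg] using hua
    have hbu : 0 < cross2 b u := by
      simp only [cross2, Prod.fst_neg, Prod.snd_neg] at hub ⊢; linarith
    have h12 : u ≠ a := by rintro rfl; simp [cross2, mul_comm] at hua
    have h13 : u ≠ -u := by
      intro h
      rw [self_eq_neg] at h
      simp [h] at hus
    have h14 : u ≠ b := by rintro rfl; simp [cross2, mul_comm] at hbu
    have h23 : a ≠ -u := by rintro rfl; simp [cross2, mul_comm] at hau
    have h24 : a ≠ b := by
      rintro rfl
      simp only [cross2] at hua hbu; linarith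
    have h34 : -u ≠ b := by rintro rfl; simp [cross2, mul_comm] at hub
    have hall : ∀ v ∈ ({u, a, -u, b} : Finset (ℝ × ℝ)), v ∈ shortStable 𝒰 := by
      simp only [Finset.mem_insert, Finset.mem_singleton]
      rintro v (rfl | rfl | rfl | rfl) <;> assumption
    refine ⟨{u, a, -u, b}, by simp, Or.inr ?_, fun v hv => (hall v hv).1, ?_,
      fun v hv => (hall v hv).2, fun w hw => ?_⟩
    · rw [Finset.card_insert_of_notMem (by simp [h12, h13, h14]),
        Finset.card_insert_of_notMem (by simp [h23, h24]), Finset.card_pair h34]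
    · refine segment_subset_convexHull (x := u) (y := -u) (by simp) (by simp)
        ⟨1 / 2, 1 / 2, by norm_num, by norm_num, by norm_num, by simp⟩
    · have hnw : cross2 (-u) w = -cross2 u w := by simp [cross2]; ring
      rcases le_total 0 (cross2 u w) with h1 | h1
      · rcases le_total (cross2 a w) 0 with h2 | h2
        · rcases shortStable.cos_le_of_mem_cone huE ha hua hw h1 h2 with h | h
          exacts [⟨u, by simp, h⟩, ⟨a, by simp, h⟩]
        · rcases shortStable.cos_le_of_mem_cone ha hneg hau hw h2 (by linarith) with h | h
          exacts [⟨a, by simp, h⟩, ⟨-u, by simp, h⟩]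
      · rcases le_total (cross2 b w) 0 with h2 | h2
        · rcases shortStable.cos_le_of_mem_cone hneg hb hub hw (by linarith) h2 with h | h
          exacts [⟨-u, by simp, h⟩, ⟨b, by simp, h⟩]
        · rcases shortStable.cos_le_of_mem_cone hb huE hbu hw h2 h1 with h | h
          exacts [⟨b, by simp, h⟩, ⟨u, by simp, h⟩]
  · obtain ⟨a, ⟨ha, hua⟩, hmin⟩ := Set.exists_min_image {a ∈ shortStable 𝒰 | 0 < cross2 u a}
      (fun a => (u.1 * a.1 + u.2 * a.2) / cross2 u a)
      ((finite_shortStable 𝒰).subset (Set.sep_subset _ _)) (left u hu.1.1)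
    obtain ⟨b, hb, hab⟩ := left a ha.1.1
    have hbs : b.1 ^ 2 + b.2 ^ 2 = 1 := hb.1.1
    have hbu : 0 < cross2 b u := by
      have hanti : cross2 b u = -cross2 u b := by simp only [cross2]; ring
      rcases lt_trichotomy (cross2 u b) 0 with h | h | h
      · linarith
      · exfalso
        have hbe : b = (u.1 * b.1 + u.2 * b.2) • u := by
          simp only [cross2] at h
          ext
          · simp only [Prod.smul_fst, smul_eq_mul]
            linear_combination -b.1 * hus - u.2 * h
          · simp only [Prod.smul_snd, smul_eq_mul]
            linear_combination -b.2 * hus + u.1 * h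
        have hsq : (u.1 * b.1 + u.2 * b.2) ^ 2 = 1 := by
          simp only [cross2] at h
          linear_combination (b.1 ^ 2 + b.2 ^ 2) * hus + hbs - (u.1 * b.2 - u.2 * b.1) * h
        rcases eq_or_eq_neg_of_sq_eq_sq _ 1 (hsq.trans (one_pow 2).symm) with h1 | h1
        · rw [h1, one_smul] at hbe
          rw [hbe] at hab
          simp only [cross2] at hab hua
          linarith
        · rw [h1, neg_one_smul] at hbe
          exact hneg (hbe ▸ hb)
      · exfalso
        have := hmin b ⟨hb, h⟩
        rw [div_le_div_iff₀ hua h] at this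
        have e : (u.1 * a.1 + u.2 * a.2) * cross2 u b - (u.1 * b.1 + u.2 * b.2) * cross2 u a =
            cross2 a b := by
          simp only [cross2]
          linear_combination (a.1 * b.2 - a.2 * b.1) * hus
        linarith
    have h12 : u ≠ a := by rintro rfl; simp [cross2, mul_comm] at hua
    have h13 : u ≠ b := by rintro rfl; simp [cross2, mul_comm] at hbu
    have h23 : a ≠ b := by rintro rfl; simp [cross2, mul_comm] at hab
    have hall : ∀ v ∈ ({u, a, b} : Finset (ℝ × ℝ)), v ∈ shortStable 𝒰 := by
      simp only [Finset.mem_insert, Finset.mem_singleton]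
      rintro v (rfl | rfl | rfl) <;> assumption
    refine ⟨{u, a, b}, by simp, Or.inl (Finset.card_eq_three.2 ⟨u, a, b, h12, h13, h23, rfl⟩),
      fun v hv => (hall v hv).1, ?_, fun v hv => (hall v hv).2, fun w hw => ?_⟩
    · have hS : 0 < cross2 a b + cross2 b u + cross2 u a := by linarith
      set S := cross2 a b + cross2 b u + cross2 u a with hSdef
      have hmem : ∀ v ∈ ({u, a, b} : Finset (ℝ × ℝ)),
          v ∈ convexHull ℝ (({u, a, b} : Finset (ℝ × ℝ)) : Set (ℝ × ℝ)) :=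
        fun v hv => subset_convexHull ℝ _ hv
      have := (convex_convexHull ℝ (({u, a, b} : Finset (ℝ × ℝ)) : Set (ℝ × ℝ))).sum_mem
        (t := Finset.univ) (w := ![cross2 a b / S, cross2 b u / S, cross2 u a / S])
        (z := ![u, a, b]) (by intro i _; fin_cases i <;> simp <;> positivity)
        (by simp [Fin.sum_univ_three, ← add_div]; rw [← hSdef, div_self hS.ne'])
        (by intro i _; fin_cases i <;> exact hmem _ (by simp))
      convert this using 1
      simp only [Fin.sum_univ_three, Matrix.cons_val]
      ext <;> simp [cross2] <;> ring
    · have hid : cross2 a b * cross2 u w + cross2 b u * cross2 a w +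
          cross2 u a * cross2 b w = 0 := by simp only [cross2]; ring
      by_cases h1 : 0 ≤ cross2 u w ∧ cross2 a w ≤ 0
      · rcases shortStable.cos_le_of_mem_cone huE ha hua hw h1.1 h1.2 with h | h
        exacts [⟨u, by simp, h⟩, ⟨a, by simp, h⟩]
      by_cases h2 : 0 ≤ cross2 a w ∧ cross2 b w ≤ 0
      · rcases shortStable.cos_le_of_mem_cone ha hb hab hw h2.1 h2.2 with h | h
        exacts [⟨a, by simp, h⟩, ⟨b, by simp, h⟩]
      by_cases h3 : 0 ≤ cross2 b w ∧ cross2 u w ≤ 0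
      · rcases shortStable.cos_le_of_mem_cone hb huE hbu hw h3.1 h3.2 with h | h
        exacts [⟨b, by simp, h⟩, ⟨u, by simp, h⟩]
      exfalso
      push Not at h1 h2 h3
      rcases le_or_gt 0 (cross2 u w) with h | h
      · have ha' := h1 h
        have hb' := h2 ha'.le
        have := mul_nonneg hab.le h
        have := mul_pos hbu ha'
        have := mul_pos hua hb'
        linarith
      · have hb' : cross2 b w < 0 := by
          by_contra! hb'
          linarith [h3 hb']
        have ha' : cross2 a w < 0 := by
          by_contra! ha'
          linarith [h2 ha']
        have := mul_neg_of_pos_of_neg hab h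
        have := mul_neg_of_pos_of_neg hbu ha'
        have := mul_neg_of_pos_of_neg hua hb'
        linarith
end

section
/- The set of stable directions of the update family 𝒰_S is exactly {u = (u₁,u₂) ∈ S¹ : u₂ ≤ 0} ∪ {(0,1)}; in particular, (0,1) is the unique isolated stable direction of 𝒰_S and 𝒰_S is critical. -/
open scoped Classical

/-- The set `W = {(x,0) : 1 ≤ x ≤ s²} ∪ {(l·s,1) : 1 ≤ l ≤ s}`. -/
noncomputable def Wset (s : ℕ) : Finset Site :=
  (Finset.Icc 1 (s ^ 2)).image (fun x => ((x : ℤ), (0 : ℤ))) ∪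
    (Finset.Icc 1 s).image (fun l => (((l * s : ℕ) : ℤ), (1 : ℤ)))

/-- The set `T = {(0,−y) : 1 ≤ y ≤ N·s²}`. -/
noncomputable def Tset (N s : ℕ) : Finset Site :=
  (Finset.Icc 1 (N * s ^ 2)).image (fun y => ((0 : ℤ), -(y : ℤ)))

/-- The rule `U₀ = {(−k,0) : 1 ≤ k ≤ N·s²} ∪ {(0,−k) : 1 ≤ k ≤ N·s²}`. -/
noncomputable def Urule0 (N s : ℕ) : Finset Site :=
  (Finset.Icc 1 (N * s ^ 2)).image (fun k => (-(k : ℤ), (0 : ℤ))) ∪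
    (Finset.Icc 1 (N * s ^ 2)).image (fun k => ((0 : ℤ), -(k : ℤ)))

/-- The rule `U₁ = {(k,0) : 1 ≤ k ≤ N·s²} ∪ {(0,−k) : 1 ≤ k ≤ N·s²}`. -/
noncomputable def Urule1 (N s : ℕ) : Finset Site :=
  (Finset.Icc 1 (N * s ^ 2)).image (fun k => ((k : ℤ), (0 : ℤ))) ∪
    (Finset.Icc 1 (N * s ^ 2)).image (fun k => ((0 : ℤ), -(k : ℤ)))

/-- The rule `U_{i,j}^k = T ∪ ((W ∪ {(i·s,2)}) − (k+(N+j)·s², 0))`. -/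
noncomputable def Uijk (N s i j k : ℕ) : Finset Site :=
  Tset N s ∪
    (Wset s ∪ {(((i * s : ℕ) : ℤ), (2 : ℤ))}).image
      (fun w => w - (((k + (N + j) * s ^ 2 : ℕ) : ℤ), (0 : ℤ)))

/-- The update family `𝒰_S = {U₀,U₁} ∪ {U_{i,j}^k : 1 ≤ i ≤ s, j ∈ S_i, 1 ≤ k ≤ s²}`
associated to a set cover instance `S`. -/
noncomputable def famS (N s : ℕ) (S : ℕ → Finset ℕ) : Finset (Finset Site) :=
  {Urule0 N s, Urule1 N s} ∪
    (((Finset.Icc 1 s ×ˢ Finset.Icc 1 N ×ˢ Finset.Icc 1 (s ^ 2)).filter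
        (fun t => t.2.1 ∈ S t.1)).image (fun t => Uijk N s t.1 t.2.1 t.2.2))

/-- `M` is a cover of the set cover instance `S_1, …, S_s` over `{1,…,N}`. -/
def IsCover (N s : ℕ) (S : ℕ → Finset ℕ) (M : Finset ℕ) : Prop :=
  M ⊆ Finset.Icc 1 s ∧ M.biUnion S = Finset.Icc 1 N

lemma mem_sphere2 {u : ℝ × ℝ} : u ∈ sphere2 ↔ u.1 ^ 2 + u.2 ^ 2 = 1 := Iff.rfl

lemma mem_halfPlane {u : ℝ × ℝ} {x : Site} :
    x ∈ halfPlane u ↔ (x.1 : ℝ) * u.1 + (x.2 : ℝ) * u.2 < 0 := Iff.rfl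

/-- Membership in the integer interval `{1, …, n}` presented as a monadic image of the natural
interval, which is how the coercions in the definitions of the rules elaborate. -/
lemma mem_natCast_Icc {n : ℕ} {x : ℤ} :
    x ∈ (do let a ← Finset.Icc 1 n; pure (a : ℤ) : Finset ℤ) ↔ ∃ a ∈ Finset.Icc 1 n, (a : ℤ) = x := by
  simp [Finset.bind_def, eq_comm]

lemma mem_famS {N s : ℕ} {S : ℕ → Finset ℕ} {U : Finset Site} (hU : U ∈ famS N s S) :
    U = Urule0 N s ∨ U = Urule1 N s ∨ ∃ i j k, U = Uijk N s i j k := by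
  simp only [famS, Finset.mem_union, Finset.mem_insert, Finset.mem_singleton,
    Finset.mem_image] at hU
  rcases hU with (h | h) | ⟨t, -, h⟩
  · exact Or.inl h
  · exact Or.inr (Or.inl h)
  · exact Or.inr (Or.inr ⟨_, _, _, h.symm⟩)

/-- Every rule of the family contains the site `(0, -1)`. -/
lemma down_mem_of_mem_famS {N s : ℕ} {S : ℕ → Finset ℕ} (hM : 1 ≤ N * s ^ 2) {U : Finset Site}
    (hU : U ∈ famS N s S) : ((0, -1) : Site) ∈ U := by
  have h1 : (1 : ℤ) ∈ (do let a ← Finset.Icc 1 (N * s ^ 2); pure (a : ℤ) : Finset ℤ) :=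
    mem_natCast_Icc.2 ⟨1, Finset.mem_Icc.2 ⟨le_rfl, hM⟩, rfl⟩
  rcases mem_famS hU with rfl | rfl | ⟨i, j, k, rfl⟩
  · exact Finset.mem_union_right _ (Finset.mem_image.2 ⟨1, h1, by simp⟩)
  · exact Finset.mem_union_right _ (Finset.mem_image.2 ⟨1, h1, by simp⟩)
  · exact Finset.mem_union_left _ (Finset.mem_image.2 ⟨1, h1, by simp⟩)

/-- Every rule of the family contains a site outside the open lower half-plane. -/
lemma exists_nonneg_of_mem_famS {N s : ℕ} {S : ℕ → Finset ℕ} (hM : 1 ≤ N * s ^ 2)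
    {U : Finset Site} (hU : U ∈ famS N s S) : ∃ x ∈ U, 0 ≤ x.2 := by
  have h1 : (1 : ℤ) ∈ (do let a ← Finset.Icc 1 (N * s ^ 2); pure (a : ℤ) : Finset ℤ) :=
    mem_natCast_Icc.2 ⟨1, Finset.mem_Icc.2 ⟨le_rfl, hM⟩, rfl⟩
  rcases mem_famS hU with rfl | rfl | ⟨i, j, k, rfl⟩
  · exact ⟨_, Finset.mem_union_left _ (Finset.mem_image_of_mem _ h1), le_rfl⟩
  · exact ⟨_, Finset.mem_union_left _ (Finset.mem_image_of_mem _ h1), le_rfl⟩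
  · exact ⟨_, Finset.mem_union_right _ (Finset.mem_image_of_mem _
      (Finset.mem_union_right _ (Finset.mem_singleton_self _))), by simp⟩

lemma Urule0_subset_halfPlane (N s : ℕ) {u : ℝ × ℝ} (h1 : 0 < u.1) (h2 : 0 < u.2) :
    (Urule0 N s : Set Site) ⊆ halfPlane u := by
  intro x hx
  simp only [Urule0, Finset.coe_union, Finset.coe_image, Set.mem_union, Set.mem_image,
    Finset.mem_coe, mem_natCast_Icc, Finset.mem_Icc] at hx
  rcases hx with ⟨_, ⟨k, ⟨hk, -⟩, rfl⟩, rfl⟩ | ⟨_, ⟨k, ⟨hk, -⟩, rfl⟩, rfl⟩ <;>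
    have hk' : (0 : ℝ) < k := Nat.cast_pos.2 hk
  · simpa [mem_halfPlane] using mul_pos hk' h1
  · simpa [mem_halfPlane] using mul_pos hk' h2

lemma Urule1_subset_halfPlane (N s : ℕ) {u : ℝ × ℝ} (h1 : u.1 < 0) (h2 : 0 < u.2) :
    (Urule1 N s : Set Site) ⊆ halfPlane u := by
  intro x hx
  simp only [Urule1, Finset.coe_union, Finset.coe_image, Set.mem_union, Set.mem_image,
    Finset.mem_coe, mem_natCast_Icc, Finset.mem_Icc] at hx
  rcases hx with ⟨_, ⟨k, ⟨hk, -⟩, rfl⟩, rfl⟩ | ⟨_, ⟨k, ⟨hk, -⟩, rfl⟩, rfl⟩ <;>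
    have hk' : (0 : ℝ) < k := Nat.cast_pos.2 hk
  · simpa [mem_halfPlane] using mul_neg_of_pos_of_neg hk' h1
  · simpa [mem_halfPlane] using mul_pos hk' h2

lemma unstable_famS_iff {N s : ℕ} {S : ℕ → Finset ℕ} (hM : 1 ≤ N * s ^ 2) {u : ℝ × ℝ} :
    Unstable (famS N s S) u ↔ 0 < u.2 ∧ u.1 ≠ 0 := by
  constructor
  · rintro ⟨U, hU, hsub⟩
    refine ⟨by simpa [mem_halfPlane] using hsub (down_mem_of_mem_famS hM hU), fun h0 => ?_⟩
    have hpos : 0 < u.2 := by simpa [mem_halfPlane] using hsub (down_mem_of_mem_famS hM hU)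
    obtain ⟨x, hx, hx2⟩ := exists_nonneg_of_mem_famS hM hU
    have hlt := mem_halfPlane.1 (hsub hx)
    rw [h0, mul_zero, zero_add] at hlt
    exact hlt.not_ge (mul_nonneg (Int.cast_nonneg hx2) hpos.le)
  · rintro ⟨h2, h1⟩
    rcases h1.lt_or_gt with h1 | h1
    · exact ⟨_, by simp [famS], Urule1_subset_halfPlane N s h1 h2⟩
    · exact ⟨_, by simp [famS], Urule0_subset_halfPlane N s h1 h2⟩

lemma stableSet_famS {N s : ℕ} (S : ℕ → Finset ℕ) (hM : 1 ≤ N * s ^ 2) :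
    stableSet (famS N s S) = {u ∈ sphere2 | u.2 ≤ 0} ∪ {((0 : ℝ), (1 : ℝ))} := by
  ext ⟨a, b⟩
  simp only [stableSet, Stable, unstable_famS_iff hM, Set.mem_ofPred_eq, Set.mem_union,
    Set.mem_singleton_iff, mem_sphere2, Prod.mk.injEq, not_and, not_not]
  constructor
  · rintro ⟨hu, h⟩
    rcases le_or_gt b 0 with hb | hb
    · exact Or.inl ⟨hu, hb⟩
    · have ha := h hb
      subst ha
      exact Or.inr ⟨rfl, by nlinarith⟩
  · rintro (⟨hu, hb⟩ | ⟨rfl, rfl⟩)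
    · exact ⟨hu, fun h => absurd h hb.not_gt⟩
    · norm_num

/-- The closed lower semicircle has no isolated points. -/
lemma mem_closure_lower_semicircle {u : ℝ × ℝ} (hu : u ∈ sphere2) (hu2 : u.2 ≤ 0) :
    u ∈ closure ({w ∈ sphere2 | w.2 ≤ 0} \ {u}) := by
  obtain ⟨a, b⟩ := u
  rw [mem_sphere2] at hu
  dsimp only at hu hu2
  have hcont : Continuous fun t : ℝ => (t, -√(1 - t ^ 2)) := by fun_prop
  have hab : (a, -√(1 - a ^ 2)) = (a, b) := by
    rw [show 1 - a ^ 2 = (-b) ^ 2 by linarith, Real.sqrt_sq (by linarith), neg_neg]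
  have hmaps : Set.MapsTo (fun t : ℝ => (t, -√(1 - t ^ 2))) (Set.Ioo (-1) 1 \ {a})
      ({w ∈ sphere2 | w.2 ≤ 0} \ {(a, b)}) := by
    rintro t ⟨⟨ht1, ht2⟩, hta⟩
    refine ⟨⟨?_, by simp⟩, fun h => hta (Prod.mk.inj h).1⟩
    rw [mem_sphere2, neg_sq, Real.sq_sqrt (by nlinarith)]
    ring
  have ha1 : -1 ≤ a := by nlinarith [sq_nonneg b]
  have ha2 : a ≤ 1 := by nlinarith [sq_nonneg b]
  have ha : a ∈ closure (Set.Ioo (-1) 1 \ {a}) := by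
    rcases le_or_gt 0 a with h | h
    · refine closure_mono (show Set.Ioo (-1) a ⊆ Set.Ioo (-1) 1 \ {a} from
        fun t ht => ⟨⟨ht.1, ht.2.trans_le ha2⟩, ht.2.ne⟩) ?_
      rw [closure_Ioo (by linarith)]
      exact ⟨ha1, le_rfl⟩
    · refine closure_mono (show Set.Ioo a 1 ⊆ Set.Ioo (-1) 1 \ {a} from
        fun t ht => ⟨⟨ha1.trans_lt ht.1, ht.2⟩, ht.1.ne'⟩) ?_
      rw [closure_Ioo (by linarith)]
      exact ⟨le_rfl, ha2⟩
  have := map_mem_closure hcont ha hmaps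
  rwa [hab] at this

section StableSet

variable {𝒰 : Finset (Finset Site)}

lemma isolatedStable_iff_of_stableSet_eq
    (h : stableSet 𝒰 = {u ∈ sphere2 | u.2 ≤ 0} ∪ {((0 : ℝ), (1 : ℝ))}) (u : ℝ × ℝ) :
    IsolatedStable 𝒰 u ↔ u = ((0 : ℝ), (1 : ℝ)) := by
  constructor
  · rintro ⟨hst, hcl⟩
    have hmem : u ∈ stableSet 𝒰 := hst
    rw [h] at hmem hcl
    rcases hmem with ⟨hu, hu2⟩ | hu
    · exact absurd (closure_mono (Set.sdiff_subset_sdiff_left Set.subset_union_left)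
        (mem_closure_lower_semicircle hu hu2)) hcl
    · exact hu
  · rintro rfl
    refine ⟨?_, fun hcl => ?_⟩
    · change _ ∈ stableSet 𝒰
      rw [h]
      exact Or.inr rfl
    · have hclosed : IsClosed {w : ℝ × ℝ | w.2 ≤ 0} := isClosed_le continuous_snd continuous_const
      have hsub : stableSet 𝒰 \ {((0 : ℝ), (1 : ℝ))} ⊆ {w : ℝ × ℝ | w.2 ≤ 0} := by
        rw [h]
        rintro w ⟨hw | hw, hne⟩
        · exact hw.2
        · exact absurd hw hne
      have : (1 : ℝ) ≤ 0 := closure_minimal hsub hclosed hcl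
      linarith

lemma critical_of_stableSet_eq
    (h : stableSet 𝒰 = {u ∈ sphere2 | u.2 ≤ 0} ∪ {((0 : ℝ), (1 : ℝ))}) : Critical 𝒰 := by
  have htop : ((0 : ℝ), (1 : ℝ)) ∈ sphere2 := by simp [mem_sphere2]
  constructor
  · rintro ⟨v, hv, hunst⟩
    have hstable : ∀ u ∈ stableSet 𝒰, u ∉ openSemicircle v := fun u hu hmem =>
      hu.2 (hunst u hmem)
    rw [h] at hstable
    rcases le_or_gt v.2 0 with hv2 | hv2
    · refine hstable v (Or.inl ⟨hv, hv2⟩) ⟨hv, ?_⟩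
      rw [mem_sphere2] at hv
      nlinarith
    · exact hstable _ (Or.inr rfl) ⟨htop, by simpa using hv2⟩
  · refine ⟨_, htop, (Set.finite_singleton ((0 : ℝ), (1 : ℝ))).subset ?_⟩
    rw [h]
    rintro u ⟨hu | hu, -, hpos⟩
    · have h2 := hu.2
      simp only [mul_zero, mul_one, zero_add] at hpos
      linarith
    · exact hu

end StableSet

/-- the stable directions of `𝒰_S` are exactly the lower closed
semicircle `{u ∈ S¹ : u₂ ≤ 0}` together with `(0,1)`; in particular `(0,1)` is
the unique isolated stable direction and `𝒰_S` is critical. -/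
theorem famS_stable_directions (N s : ℕ) (hN : 4 ≤ N) (hs : 4 ≤ s)
    (S : ℕ → Finset ℕ) (hS : ∀ i ∈ Finset.Icc 1 s, S i ⊆ Finset.Icc 1 N)
    (hcov : (Finset.Icc 1 s).biUnion S = Finset.Icc 1 N) :
    stableSet (famS N s S) = {u ∈ sphere2 | u.2 ≤ 0} ∪ {((0 : ℝ), (1 : ℝ))} ∧
      (∀ u : ℝ × ℝ, IsolatedStable (famS N s S) u ↔ u = ((0 : ℝ), (1 : ℝ))) ∧
      Critical (famS N s S) := by
  have hM : 1 ≤ N * s ^ 2 := Nat.mul_pos (by omega) (pow_pos (by omega) 2)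
  have h := stableSet_famS S hM
  exact ⟨h, isolatedStable_iff_of_stableSet_eq h, critical_of_stableSet_eq h⟩
end

section
/- Let k ≥ 2 be an integer and consider the one-dimensional update family with rules U₁ = {k, k−1} and U₂ = {−k, −k+1}. Then there does not exist a set Z ⊆ ℤ with |Z| < k whose closure [Z] is infinite; equivalently, every Z ⊆ ℤ with fewer than k elements has finite closure. -/
open scoped Classical

/-- The image of the square `[0, m) × [0, m)` under `(a, b) ↦ c + k * b - (k - 1) * a`. -/
def skewSquare (k c : ℤ) (m : ℕ) : Set ℤ :=
  {x | ∃ a b : ℤ, 0 ≤ a ∧ a < m ∧ 0 ≤ b ∧ b < m ∧ x = c + k * b - (k - 1) * a}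

theorem finite_skewSquare (k c : ℤ) (m : ℕ) : (skewSquare k c m).Finite := by
  refine (((Set.finite_Ico (0 : ℤ) m).prod (Set.finite_Ico (0 : ℤ) m)).image
    fun p => c + k * p.2 - (k - 1) * p.1).subset ?_
  rintro x ⟨a, b, ha, ha', hb, hb', rfl⟩
  exact ⟨(a, b), ⟨⟨ha, ha'⟩, hb, hb'⟩, rfl⟩

/-- A set is stable if every pair of consecutive elements `x, x + 1` brings along `x + k`
and `x + 1 - k`. -/
def IsPairStable (k : ℤ) (S : Set ℤ) : Prop :=
  ∀ x ∈ S, x + 1 ∈ S → x + k ∈ S ∧ x + 1 - k ∈ S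

theorem isPairStable_skewSquare {k c : ℤ} {m : ℕ} (hm : m < k) :
    IsPairStable k (skewSquare k c m) := by
  rintro x ⟨a, b, ha, ha', hb, hb', hx⟩ ⟨a', b', ha₁, ha₁', hb₁, hb₁', hx'⟩
  have hdvd : k ∣ a' - a - 1 := ⟨a' - a - (b' - b), by linarith⟩
  have hlt : |a' - a - 1| < k := by rw [abs_lt]; omega
  have h0 := Int.eq_zero_of_abs_lt_dvd hdvd hlt
  obtain rfl : a' = a + 1 := by omega
  have hb : k * (b' - b - 1) = 0 := by linarith
  have hk : k ≠ 0 := by omega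
  have hb0 := (mul_eq_zero.mp hb).resolve_left hk
  obtain rfl : b' = b + 1 := by omega
  exact ⟨⟨a, b + 1, by omega, by omega, by omega, by omega, by rw [hx]; ring⟩,
    ⟨a + 1, b, by omega, by omega, by omega, by omega, by rw [hx]; ring⟩⟩

/-- Two skew squares containing consecutive integers fit in one skew square whose side is the
sum of their sides. -/
theorem exists_skewSquare_superset {k c d x : ℤ} {m n : ℕ}
    (hx : x ∈ skewSquare k c m) (hx' : x + 1 ∈ skewSquare k d n) :
    ∃ e, skewSquare k c m ⊆ skewSquare k e (m + n) ∧
      skewSquare k d n ⊆ skewSquare k e (m + n) := by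
  obtain ⟨a₁, b₁, ha₁, ha₁', hb₁, hb₁', hx⟩ := hx
  obtain ⟨a₂, b₂, ha₂, ha₂', hb₂, hb₂', hx'⟩ := hx'
  obtain ⟨A, hA⟩ : ∃ A, A = a₁ + 1 - a₂ := ⟨_, rfl⟩
  obtain ⟨B, hB⟩ : ∃ B, B = b₁ + 1 - b₂ := ⟨_, rfl⟩
  have hd : d = c + k * B - (k - 1) * A := by rw [hA, hB]; linarith
  refine ⟨c + k * min 0 B - (k - 1) * min 0 A, ?_, ?_⟩
  · rintro y ⟨a, b, ha, ha', hb, hb', rfl⟩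
    exact ⟨a - min 0 A, b - min 0 B, by omega, by push_cast; omega, by omega,
      by push_cast; omega, by ring⟩
  · rintro y ⟨a, b, ha, ha', hb, hb', rfl⟩
    exact ⟨a + A - min 0 A, b + B - min 0 B, by omega, by push_cast; omega, by omega,
      by push_cast; omega, by rw [hd]; ring⟩

/-- Skew squares of total side less than `k` are contained in a finite stable set. -/
theorem exists_finite_isPairStable {k : ℤ} (L : Multiset (ℤ × ℕ))
    (hL : ((L.map Prod.snd).sum : ℤ) < k) :
    ∃ S : Set ℤ, S.Finite ∧ IsPairStable k S ∧ ∀ s ∈ L, skewSquare k s.1 s.2 ⊆ S := by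
  induction hn : L.card using Nat.strong_induction_on generalizing L with
  | _ n ih =>
    by_cases hmerge : ∃ s ∈ L, ∃ t ∈ L, s ≠ t ∧
        ∃ x, x ∈ skewSquare k s.1 s.2 ∧ x + 1 ∈ skewSquare k t.1 t.2
    · obtain ⟨s, hs, t, ht, hne, x, hxs, hxt⟩ := hmerge
      obtain ⟨L', rfl⟩ := Multiset.exists_cons_of_mem hs
      obtain ⟨M, rfl⟩ := Multiset.exists_cons_of_mem
        ((Multiset.mem_cons.mp ht).resolve_left hne.symm)
      obtain ⟨e, hse, hte⟩ := exists_skewSquare_superset hxs hxt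
      simp only [Multiset.card_cons] at hn
      simp only [Multiset.map_cons, Multiset.sum_cons] at hL
      obtain ⟨S, hfin, hS, hsub⟩ := ih (M.card + 1) (by omega) ((e, s.2 + t.2) ::ₘ M)
        (by simp only [Multiset.map_cons, Multiset.sum_cons]; push_cast at hL ⊢; omega)
        (by simp)
      simp only [Multiset.forall_mem_cons] at hsub ⊢
      exact ⟨S, hfin, hS, hse.trans hsub.1, hte.trans hsub.1, hsub.2⟩
    · refine ⟨⋃ s ∈ L.toFinset, skewSquare k s.1 s.2,
        L.toFinset.finite_toSet.biUnion fun s _ => finite_skewSquare k s.1 s.2, ?_, ?_⟩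
      · intro x hx hx'
        simp only [Set.mem_iUnion, Multiset.mem_toFinset, exists_prop] at hx hx' ⊢
        obtain ⟨s, hs, hxs⟩ := hx
        obtain ⟨t, ht, hxt⟩ := hx'
        obtain rfl : s = t := by
          by_contra hne
          exact hmerge ⟨s, hs, t, ht, hne, x, hxs, hxt⟩
        have hle := Multiset.single_le_sum (fun _ _ => Nat.zero_le _) _
          (Multiset.mem_map_of_mem Prod.snd hs)
        have hstab := isPairStable_skewSquare (c := s.1) (m := s.2) (k := k) (by omega) x hxs hxt
        exact ⟨⟨s, hs, hstab.1⟩, ⟨s, hs, hstab.2⟩⟩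
      · intro s hs
        exact Set.subset_biUnion_of_mem (u := fun s : ℤ × ℕ => skewSquare k s.1 s.2)
          (Multiset.mem_toFinset.mpr hs)

theorem bpClosure1_subset_of_bpStep1_subset {𝒰 : Finset (Finset ℤ)} {A S : Set ℤ} (hA : A ⊆ S)
    (hS : ∀ U ∈ 𝒰, ∀ x, (∀ y ∈ U, x + y ∈ S) → x ∈ S) : bpClosure1 𝒰 A ⊆ S := by
  refine Set.iUnion_subset fun n => ?_
  induction n with
  | zero => exact hA
  | succ n ih =>
    rintro x (hx | ⟨U, hU, hx⟩)
    · exact ih hx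
    · exact hS U hU x fun y hy => ih (hx y hy)

/-- for the one-dimensional family with rules `U₁ = {k, k−1}` and
`U₂ = {−k, −k+1}` (`k ≥ 2`), every set `Z ⊆ ℤ` with fewer than `k` elements has
finite closure. -/
theorem one_dim_no_small_spanning (k : ℕ) (hk : 2 ≤ k) (Z : Finset ℤ)
    (hZ : Z.card < k) :
    (bpClosure1
      ({({(k : ℤ), (k : ℤ) - 1} : Finset ℤ), ({-(k : ℤ), -(k : ℤ) + 1} : Finset ℤ)} :
        Finset (Finset ℤ)) (Z : Set ℤ)).Finite := by
  obtain ⟨S, hfin, hS, hsub⟩ := exists_finite_isPairStable (k := k)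
    (Z.val.map fun z => (z, 1)) (by simpa using hZ)
  refine hfin.subset (bpClosure1_subset_of_bpStep1_subset (fun z hz => ?_) ?_)
  · refine hsub (z, 1) (Multiset.mem_map.mpr ⟨z, hz, rfl⟩) ⟨0, 0, ?_⟩
    simp
  · intro U hU x hx
    simp only [Finset.mem_insert, Finset.mem_singleton] at hU
    rcases hU with rfl | rfl
    · simp only [Finset.mem_insert, Finset.mem_singleton, forall_eq_or_imp, forall_eq] at hx
      have h := (hS (x + (k - 1)) hx.2 (by convert hx.1 using 1; ring)).2
      convert h using 1
      ring
    · simp only [Finset.mem_insert, Finset.mem_singleton, forall_eq_or_imp, forall_eq] at hx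
      have h := (hS (x + -k) hx.1 (by convert hx.2 using 1; ring)).1
      convert h using 1
      ring
end
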